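/- arXiv:0806.3150 — 2 statements merged into one kernel-verified Lean document; each statement's English description precedes it below -/
import Mathlib

section
/- For every A ∈ (0,1) there exist δ ∈ (0,1/8) and a continuous increasing function C_A : [0,∞) → [0,∞) with the following property: for all real-valued φ₀, φ₁ ∈ H¹(ℝ²) that are (1/4−δ)-Hölder continuous, lie in L⁸(ℝ²) ∩ L^{2/δ}(ℝ²), and satisfy ‖φ_j‖_{H¹[6]} ≤ A for j = 0,1, one has ‖f(φ₁) − f(φ₀)‖_{L²(ℝ²)} ≤ C_A(max(‖φ₀‖_{H¹}, ‖φ₁‖_{H¹})) · (max_{j=0,1}(‖φ_j‖_{C^{1/4−δ}} + ‖φ_j‖_{L⁸}))⁴ · ‖φ₁ − φ₀‖_{L^{2/δ}(ℝ²)}. -/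
open MeasureTheory Real Classical
open scoped ENNReal RealInnerProductSpace

noncomputable section

/-- The plane `ℝ²`. -/
abbrev Plane := EuclideanSpace ℝ (Fin 2)

/-- Pointwise norm of the (full) gradient of `u`. -/
def gradNorm (u : Plane → ℝ) (x : Plane) : ℝ := ‖fderiv ℝ u x‖

/-- The `L^p` norm for a real (finite) exponent `p`. -/
def LpNorm (p : ℝ) (u : Plane → ℝ) : ℝ := (∫ x : Plane, |u x| ^ p) ^ (1 / p)

/-- The sup (`L^∞`) norm. -/
def supNorm (u : Plane → ℝ) : ℝ := ⨆ x : Plane, |u x|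

/-- The homogeneous Hölder seminorm `[u]_α`. -/
def holderSemi (α : ℝ) (u : Plane → ℝ) : ℝ :=
  ⨆ p : Plane × Plane,
    if p.1 = p.2 then 0 else |u p.1 - u p.2| / ‖p.1 - p.2‖ ^ α

/-- The Hölder norm `‖u‖_{C^α} = sup |u| + [u]_α`. -/
def holderNorm (α : ℝ) (u : Plane → ℝ) : ℝ := supNorm u + holderSemi α u

/-- `u` is `α`-Hölder continuous. -/
def IsHolder (α : ℝ) (u : Plane → ℝ) : Prop :=
  ∃ C : ℝ, 0 ≤ C ∧ ∀ x y : Plane, |u x - u y| ≤ C * ‖x - y‖ ^ α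

/-- The squared `H¹` norm `‖∇u‖_{L²}² + ‖u‖_{L²}²`. -/
def H1Sq (u : Plane → ℝ) : ℝ :=
  (∫ x : Plane, gradNorm u x ^ 2) + ∫ x : Plane, u x ^ 2

/-- The squared local `H¹` norm `‖u‖_{H¹[R]}²`. -/
def H1locSq (R : ℝ) (u : Plane → ℝ) : ℝ :=
  ⨆ c : Plane, ∫ x in Metric.closedBall c R, (gradNorm u x ^ 2 + u x ^ 2)

/-- Membership in `H¹(ℝ²)` (with classical derivatives). -/
def MemH1 (u : Plane → ℝ) : Prop :=
  Differentiable ℝ u ∧ Integrable (fun x => u x ^ 2) ∧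
    Integrable (fun x => gradNorm u x ^ 2)

/-- The nonlinearity `f(u) = (e^{4π u²} - 1 - 4π u²) u`. -/
def f (s : ℝ) : ℝ := (Real.exp (4 * π * s ^ 2) - 1 - 4 * π * s ^ 2) * s

/-- The potential `F(u) = (1/8π)(e^{4π u²} - 1 - 4π u² - 8π² u⁴)`. -/
def F (s : ℝ) : ℝ :=
  (8 * π)⁻¹ * (Real.exp (4 * π * s ^ 2) - 1 - 4 * π * s ^ 2 - 8 * π ^ 2 * s ^ 4)

theorem lintegral_ofReal_norm_plane {g : ℝ → ℝ} (hg : ∀ r, 0 ≤ g r)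
    (hi : IntegrableOn (fun r => r * g r) (Set.Ioi 0)) :
    ∫⁻ y : Plane, ENNReal.ofReal (g ‖y‖) =
      ENNReal.ofReal (2 * π * ∫ r in Set.Ioi (0:ℝ), r * g r) := by
  have hd : Module.finrank ℝ Plane = 2 := by simp
  have hI : Integrable (fun y : Plane => g ‖y‖) := by
    rw [integrable_fun_norm_addHaar volume (f := g), hd]
    simpa using hi
  rw [← ofReal_integral_eq_lintegral_ofReal hI (Filter.Eventually.of_forall fun y => hg _),
    integral_fun_norm_addHaar volume g, hd]
  congr 1
  simp [Measure.real, EuclideanSpace.volume_ball_fin_two, mul_assoc, Real.pi_pos.le]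

theorem lintegral_ball_inv_norm {ρ : ℝ} (hρ : 0 < ρ) :
    ∫⁻ y in Metric.ball (0 : Plane) ρ, ENNReal.ofReal ‖y‖⁻¹ = ENNReal.ofReal (2 * π * ρ) := by
  have key : Set.EqOn (fun r : ℝ => r * (Set.Ioo 0 ρ).indicator (fun r => r⁻¹) r)
      ((Set.Ioo 0 ρ).indicator fun _ => 1) (Set.Ioi 0) := by
    intro r hr
    by_cases h : r ∈ Set.Ioo 0 ρ
    · simp [Set.indicator_of_mem h, (ne_of_gt hr : r ≠ 0)]
    · simp [Set.indicator_of_notMem h]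
  have h1 := lintegral_ofReal_norm_plane (g := (Set.Ioo 0 ρ).indicator fun r => r⁻¹)
    (fun r => Set.indicator_nonneg (fun r hr => (inv_pos.2 hr.1).le) r) (by
      rw [integrableOn_congr_fun key measurableSet_Ioi]
      exact ((integrable_indicator_iff measurableSet_Ioo).2 (by simp)).integrableOn)
  rw [setIntegral_congr_fun measurableSet_Ioi key, setIntegral_indicator measurableSet_Ioo,
    Set.inter_eq_self_of_subset_right Set.Ioo_subset_Ioi_self] at h1
  simp only [integral_const, MeasurableSet.univ, measureReal_restrict_apply, Set.univ_inter,
    Real.volume_real_Ioo, sub_zero, max_eq_left hρ.le, smul_eq_mul, mul_one] at h1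
  rw [← h1, ← lintegral_indicator measurableSet_ball]
  refine lintegral_congr fun y => ?_
  rcases eq_or_ne y 0 with rfl | hy
  · simp [Set.indicator]
  · have := norm_pos_iff.2 hy
    by_cases h : ‖y‖ < ρ <;> simp [Set.indicator, h, this]

theorem lintegral_annulus_inv_norm_sq {ρ : ℝ} (hρ : 0 < ρ) (hρ1 : ρ ≤ 1) :
    ∫⁻ y in Metric.ball (0 : Plane) 1 \ Metric.ball 0 ρ, ENNReal.ofReal ‖y‖⁻¹ ^ 2 =
      ENNReal.ofReal (2 * π * Real.log (1 / ρ)) := by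
  have key : Set.EqOn (fun r : ℝ => r * (Set.Ico ρ 1).indicator (fun r => r⁻¹ ^ 2) r)
      ((Set.Ico ρ 1).indicator fun r => 1 / r) (Set.Ioi 0) := by
    intro r hr
    by_cases h : r ∈ Set.Ico ρ 1
    · have : r ≠ 0 := ne_of_gt hr
      simp only [Set.indicator_of_mem h]
      field_simp
    · simp [Set.indicator_of_notMem h]
  have hii : IntegrableOn (fun r : ℝ => 1 / r) (Set.Ico ρ 1) := by
    have : ContinuousOn (fun r : ℝ => 1 / r) (Set.Icc ρ 1) := by
      refine continuousOn_const.div continuousOn_id fun r hr => (hρ.trans_le hr.1).ne'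
    exact this.integrableOn_Icc.mono_set Set.Ico_subset_Icc_self
  have h1 := lintegral_ofReal_norm_plane (g := (Set.Ico ρ 1).indicator fun r => r⁻¹ ^ 2)
    (fun r => Set.indicator_nonneg (fun r hr => by positivity) r) (by
      rw [integrableOn_congr_fun key measurableSet_Ioi]
      exact ((integrable_indicator_iff measurableSet_Ico).2 hii).integrableOn)
  have hsub : Set.Ico ρ 1 ⊆ Set.Ioi 0 := fun r hr => hρ.trans_le hr.1
  rw [setIntegral_congr_fun measurableSet_Ioi key, setIntegral_indicator measurableSet_Ico,
    Set.inter_eq_self_of_subset_right hsub, integral_Ico_eq_integral_Ioc,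
    ← intervalIntegral.integral_of_le hρ1, integral_one_div_of_pos hρ one_pos] at h1
  rw [← h1, ← lintegral_indicator (measurableSet_ball.diff measurableSet_ball)]
  refine lintegral_congr fun y => ?_
  by_cases h : ρ ≤ ‖y‖ <;> by_cases h' : ‖y‖ < 1 <;>
    simp [Set.indicator, h, h', ← ENNReal.ofReal_pow]

theorem lintegral_mul_sq_le {α : Type*} [MeasurableSpace α] (μ : Measure α) {u v : α → ℝ≥0∞}
    (hu : AEMeasurable u μ) (hv : AEMeasurable v μ) :
    (∫⁻ x, u x * v x ∂μ) ^ 2 ≤ (∫⁻ x, u x ^ 2 ∂μ) * ∫⁻ x, v x ^ 2 ∂μ := by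
  have h := ENNReal.lintegral_mul_le_Lp_mul_Lq μ Real.HolderConjugate.two_two hu hv
  simp only [Pi.mul_apply, ENNReal.rpow_two] at h
  calc _ ≤ _ := pow_le_pow_left₀ (zero_le) h 2
    _ = _ := by
      rw [mul_pow, ← ENNReal.rpow_natCast, ← ENNReal.rpow_natCast, ← ENNReal.rpow_mul,
        ← ENNReal.rpow_mul]
      norm_num

/-- The fundamental theorem of calculus along a segment, for a differentiable function. -/
theorem enorm_le_add_lintegral_segment {u : Plane → ℝ} (hu : Differentiable ℝ u) (x z : Plane) :
    ‖u x‖ₑ ≤ ‖u (x + z)‖ₑ + ∫⁻ s in Set.Ioc (0:ℝ) 1, ‖fderiv ℝ u (x + s • z)‖ₑ * ‖z‖ₑ := by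
  by_cases hfin : ∫⁻ s in Set.Ioc (0:ℝ) 1, ‖fderiv ℝ u (x + s • z)‖ₑ * ‖z‖ₑ = ∞
  · simp [hfin]
  have hder : ∀ s : ℝ, HasDerivAt (fun s : ℝ => u (x + s • z)) (fderiv ℝ u (x + s • z) z) s := by
    intro s
    have h1 : HasDerivAt (fun s : ℝ => x + s • z) z s := by
      simpa using ((hasDerivAt_id s).smul_const z).const_add x
    exact (hu (x + s • z)).hasFDerivAt.comp_hasDerivAt s h1
  have hbd : ∀ s : ℝ, ‖fderiv ℝ u (x + s • z) z‖ₑ ≤ ‖fderiv ℝ u (x + s • z)‖ₑ * ‖z‖ₑ :=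
    fun s => ContinuousLinearMap.le_opENorm _ _
  have hle : ∫⁻ s in Set.Ioc (0:ℝ) 1, ‖fderiv ℝ u (x + s • z) z‖ₑ ≤
      ∫⁻ s in Set.Ioc (0:ℝ) 1, ‖fderiv ℝ u (x + s • z)‖ₑ * ‖z‖ₑ := lintegral_mono fun s => hbd s
  have hmeas : Measurable fun s : ℝ => fderiv ℝ u (x + s • z) z :=
    (measurable_fderiv_apply_const ℝ u z).comp (by fun_prop)
  have hint : IntervalIntegrable (fun s : ℝ => fderiv ℝ u (x + s • z) z) volume 0 1 := by
    rw [intervalIntegrable_iff_integrableOn_Ioc_of_le zero_le_one]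
    exact ⟨hmeas.aestronglyMeasurable, hle.trans_lt (lt_top_iff_ne_top.2 hfin)⟩
  have h := intervalIntegral.integral_eq_sub_of_hasDerivAt (fun s _ => hder s) hint
  simp only [one_smul, zero_smul, add_zero] at h
  have hux : u x = u (x + z) - ∫ s in (0:ℝ)..1, fderiv ℝ u (x + s • z) z := by rw [h]; ring
  rw [hux]
  refine enorm_sub_le.trans (add_le_add le_rfl ?_)
  rw [intervalIntegral.integral_of_le zero_le_one]
  exact (enorm_integral_le_lintegral_enorm _).trans hle

theorem lintegral_comp_smul_plane {H : Plane → ℝ≥0∞} (hH : Measurable H) {s : ℝ} (hs : 0 < s) :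
    ∫⁻ z, H (s • z) = ENNReal.ofReal (s⁻¹ ^ 2) * ∫⁻ y, H y := by
  rw [← lintegral_map (g := fun z : Plane => s • z) hH (by fun_prop),
    Measure.map_addHaar_smul volume hs.ne', lintegral_smul_measure]
  simp [abs_of_pos hs]

theorem lintegral_Ioi_inv_cube {a : ℝ} (ha : 0 < a) :
    ∫⁻ s in Set.Ioi a, ENNReal.ofReal (s⁻¹ ^ 3) = ENNReal.ofReal (1 / 2 * a⁻¹ ^ 2) := by
  have e : Set.EqOn (fun s : ℝ => ENNReal.ofReal (s⁻¹ ^ 3))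
      (fun s => ENNReal.ofReal (s ^ (-3 : ℝ))) (Set.Ioi a) := by
    intro s hs
    have : 0 < s := ha.trans hs
    simp only
    rw [Real.rpow_neg this.le, inv_pow]
    norm_cast
  rw [setLIntegral_congr_fun measurableSet_Ioi e, ← ofReal_integral_eq_lintegral_ofReal
    (integrableOn_Ioi_rpow_of_lt (by norm_num) ha), integral_Ioi_rpow_of_lt (by norm_num) ha]
  · congr 1
    rw [show (-3 + 1 : ℝ) = -(2 : ℕ) by norm_num, Real.rpow_neg ha.le, Real.rpow_natCast]
    push_cast
    field_simp
  · filter_upwards [ae_restrict_mem measurableSet_Ioi] with s hs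
    exact Real.rpow_nonneg (ha.trans hs).le _

theorem lintegral_segments_le {G : Plane → ℝ≥0∞} (hG : Measurable G) :
    ∫⁻ z in Metric.ball (0 : Plane) 1, ∫⁻ s in Set.Ioc (0:ℝ) 1, G (s • z) * ‖z‖ₑ ≤
      ENNReal.ofReal (1 / 2) *
        ∫⁻ y in Metric.ball (0 : Plane) 1, G y * ENNReal.ofReal ‖y‖⁻¹ := by
  let H : ℝ → Plane → ℝ≥0∞ := fun s y =>
    (Metric.ball (0 : Plane) s).indicator (fun y => G y * ‖y‖ₑ * ENNReal.ofReal s⁻¹) y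
  have hscale : ∀ s ∈ Set.Ioc (0:ℝ) 1, ∫⁻ z in Metric.ball (0 : Plane) 1, G (s • z) * ‖z‖ₑ =
      ∫⁻ y in Metric.ball (0 : Plane) 1, G y * ‖y‖ₑ *
        (Set.Ioi ‖y‖).indicator (fun s => ENNReal.ofReal (s⁻¹ ^ 3)) s := by
    intro s hs
    have hs0 := hs.1
    have h1 : ∫⁻ z in Metric.ball (0 : Plane) 1, G (s • z) * ‖z‖ₑ = ∫⁻ z, H s (s • z) := by
      rw [← lintegral_indicator measurableSet_ball]
      refine lintegral_congr fun z => ?_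
      have hmem : s • z ∈ Metric.ball (0 : Plane) s ↔ z ∈ Metric.ball (0 : Plane) 1 := by
        simp [norm_smul, abs_of_pos hs0, hs0]
      by_cases h : z ∈ Metric.ball (0 : Plane) 1
      · simp only [H, Set.indicator_of_mem h, Set.indicator_of_mem (hmem.2 h)]
        rw [mul_assoc, enorm_smul, mul_comm ‖s‖ₑ, mul_assoc, Real.enorm_eq_ofReal hs0.le,
          ← ENNReal.ofReal_mul hs0.le, mul_inv_cancel₀ hs0.ne']
        simp
      · simp only [H, Set.indicator_of_notMem h, Set.indicator_of_notMem (mt hmem.1 h)]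
    have hHm : Measurable (H s) :=
      Measurable.indicator (by fun_prop) measurableSet_ball
    rw [h1, lintegral_comp_smul_plane hHm hs0, ← lintegral_const_mul _ hHm,
      ← lintegral_indicator measurableSet_ball]
    refine lintegral_congr fun y => ?_
    by_cases h : ‖y‖ < s
    · have h' : ‖y‖ < 1 := h.trans_le hs.2
      simp only [H, Set.indicator, mem_ball_zero_iff, h, h', Set.mem_Ioi, if_true]
      rw [show s⁻¹ ^ 3 = s⁻¹ ^ 2 * s⁻¹ by ring, ENNReal.ofReal_mul (by positivity)]
      ring
    · simp [H, Set.indicator, h]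
  have hm1 : Measurable (Function.uncurry fun (z : Plane) (s : ℝ) => G (s • z) * ‖z‖ₑ) := by
    unfold Function.uncurry; fun_prop
  have hm2 : Measurable (Function.uncurry fun (s : ℝ) (y : Plane) => G y * ‖y‖ₑ *
        (Set.Ioi ‖y‖).indicator (fun s => ENNReal.ofReal (s⁻¹ ^ 3)) s) := by
    have : Measurable fun p : ℝ × Plane => {p : ℝ × Plane | ‖p.2‖ < p.1}.indicator
        (fun p => ENNReal.ofReal (p.1⁻¹ ^ 3)) p :=
      Measurable.indicator (by fun_prop) (measurableSet_lt (by fun_prop) (by fun_prop))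
    exact ((hG.comp measurable_snd).mul (by fun_prop)).mul this
  rw [lintegral_lintegral_swap hm1.aemeasurable, setLIntegral_congr_fun measurableSet_Ioc hscale,
    lintegral_lintegral_swap hm2.aemeasurable, ← lintegral_const_mul' _ _ (by simp)]
  refine lintegral_mono fun y => ?_
  rcases eq_or_ne y 0 with rfl | hy
  · simp
  have hy0 : 0 < ‖y‖ := norm_pos_iff.2 hy
  rw [lintegral_const_mul _ (Measurable.indicator (by fun_prop) measurableSet_Ioi)]
  calc _ ≤ G y * ‖y‖ₑ * ENNReal.ofReal (1 / 2 * ‖y‖⁻¹ ^ 2) := by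
        gcongr
        rw [← lintegral_Ioi_inv_cube hy0, ← lintegral_indicator measurableSet_Ioi]
        exact setLIntegral_le_lintegral _ _
    _ = _ := by
        rw [← ofReal_norm, mul_assoc, ← ENNReal.ofReal_mul hy0.le,
          mul_left_comm (ENNReal.ofReal (1 / 2)),
          ← ENNReal.ofReal_mul (by norm_num)]
        congr 2
        field_simp

theorem pi_mul_enorm_le_potential {u : Plane → ℝ} (hu : Differentiable ℝ u) (x : Plane) :
    ENNReal.ofReal π * ‖u x‖ₑ ≤ (∫⁻ y in Metric.ball (0 : Plane) 1, ‖u (x + y)‖ₑ) +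
      ENNReal.ofReal (1 / 2) * ∫⁻ y in Metric.ball (0 : Plane) 1,
        ‖fderiv ℝ u (x + y)‖ₑ * ENNReal.ofReal ‖y‖⁻¹ := by
  have hG : Measurable fun y => ‖fderiv ℝ u (x + y)‖ₑ :=
    ((measurable_fderiv ℝ u).comp (by fun_prop : Measurable fun y => x + y)).enorm
  have hc : Measurable fun y => ‖u (x + y)‖ₑ :=
    (hu.continuous.measurable.comp (by fun_prop : Measurable fun y => x + y)).enorm
  calc ENNReal.ofReal π * ‖u x‖ₑ = ∫⁻ _ in Metric.ball (0 : Plane) 1, ‖u x‖ₑ := by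
        simp [EuclideanSpace.volume_ball_fin_two, mul_comm]
    _ ≤ ∫⁻ z in Metric.ball (0 : Plane) 1, (‖u (x + z)‖ₑ +
          ∫⁻ s in Set.Ioc (0:ℝ) 1, ‖fderiv ℝ u (x + s • z)‖ₑ * ‖z‖ₑ) :=
        lintegral_mono fun z => enorm_le_add_lintegral_segment hu x z
    _ ≤ _ := by
        rw [lintegral_add_left hc]
        exact add_le_add le_rfl (lintegral_segments_le hG)

theorem lintegral_sq_near_potential_le {G : Plane → ℝ≥0∞} (hG : Measurable G) {ρ : ℝ}
    (hρ : 0 < ρ) :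
    ∫⁻ x, (∫⁻ y in Metric.ball (0 : Plane) ρ, G (x + y) * ENNReal.ofReal ‖y‖⁻¹) ^ 2 ≤
      ENNReal.ofReal (2 * π * ρ) ^ 2 * ∫⁻ x, G x ^ 2 := by
  have hpt : ∀ x, (∫⁻ y in Metric.ball (0 : Plane) ρ, G (x + y) * ENNReal.ofReal ‖y‖⁻¹) ^ 2 ≤
      (∫⁻ y in Metric.ball (0 : Plane) ρ, G (x + y) ^ 2 * ENNReal.ofReal ‖y‖⁻¹) *
        ENNReal.ofReal (2 * π * ρ) := by
    intro x
    have h := lintegral_mul_sq_le (volume.restrict (Metric.ball (0 : Plane) ρ))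
      (u := fun y => G (x + y) * ENNReal.ofReal (√‖y‖⁻¹))
      (v := fun y => ENNReal.ofReal (√‖y‖⁻¹)) (by fun_prop) (by fun_prop)
    have hs : ∀ y : Plane, ENNReal.ofReal (√‖y‖⁻¹) ^ 2 = ENNReal.ofReal ‖y‖⁻¹ := by
      intro y
      rw [← ENNReal.ofReal_pow (Real.sqrt_nonneg _), Real.sq_sqrt (by positivity)]
    simp only [mul_pow, mul_assoc, ← sq, hs] at h
    rwa [lintegral_ball_inv_norm hρ] at h
  have hm : Measurable (Function.uncurry fun (x y : Plane) =>
      G (x + y) ^ 2 * ENNReal.ofReal ‖y‖⁻¹) := by unfold Function.uncurry; fun_prop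
  calc _ ≤ ∫⁻ x, (∫⁻ y in Metric.ball (0 : Plane) ρ, G (x + y) ^ 2 * ENNReal.ofReal ‖y‖⁻¹) *
        ENNReal.ofReal (2 * π * ρ) := lintegral_mono hpt
    _ = (∫⁻ y in Metric.ball (0 : Plane) ρ, (∫⁻ x, G x ^ 2) * ENNReal.ofReal ‖y‖⁻¹) *
        ENNReal.ofReal (2 * π * ρ) := by
      rw [lintegral_mul_const' _ _ (by simp), lintegral_lintegral_swap hm.aemeasurable]
      congr 1
      refine lintegral_congr fun y => ?_
      rw [lintegral_mul_const _ (by fun_prop),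
        lintegral_add_right_eq_self (fun x => G x ^ 2) y]
    _ = _ := by
      rw [lintegral_const_mul _ (by fun_prop), lintegral_ball_inv_norm hρ]
      ring

theorem sq_far_potential_le {G : Plane → ℝ≥0∞} (hG : Measurable G) {ρ : ℝ}
    (hρ : 0 < ρ) (hρ1 : ρ ≤ 1) :
    (∫⁻ y in Metric.ball (0 : Plane) 1 \ Metric.ball 0 ρ, G y * ENNReal.ofReal ‖y‖⁻¹) ^ 2 ≤
      (∫⁻ y in Metric.ball (0 : Plane) 1, G y ^ 2) * ENNReal.ofReal (2 * π * Real.log (1 / ρ)) := by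
  refine (lintegral_mul_sq_le _ (by fun_prop) (by fun_prop)).trans ?_
  rw [lintegral_annulus_inv_norm_sq hρ hρ1]
  gcongr
  exact Set.sdiff_subset

theorem setLIntegral_ball_comp_add (G : Plane → ℝ≥0∞) (x : Plane) (r : ℝ) :
    ∫⁻ y in Metric.ball (0 : Plane) r, G (x + y) = ∫⁻ y in Metric.ball x r, G y := by
  rw [← lintegral_indicator measurableSet_ball, ← lintegral_indicator measurableSet_ball,
    ← lintegral_add_left_eq_self ((Metric.ball x r).indicator G) x]
  refine lintegral_congr fun y => ?_
  simp [Set.indicator]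

theorem gradNorm_sq_enorm (u : Plane → ℝ) (x : Plane) :
    ‖fderiv ℝ u x‖ₑ ^ 2 = ENNReal.ofReal (gradNorm u x ^ 2) := by
  rw [← ofReal_norm, ← ENNReal.ofReal_pow (norm_nonneg _)]; rfl

theorem setLIntegral_ball_le_of_H1locSq {u : Plane → ℝ} (hu : MemH1 u) {A : ℝ}
    (hloc : H1locSq 6 u ≤ A ^ 2) (x : Plane) :
    (∫⁻ y in Metric.ball x 1, ‖u y‖ₑ ^ 2) ≤ ENNReal.ofReal (A ^ 2) ∧
    (∫⁻ y in Metric.ball x 1, ‖fderiv ℝ u y‖ₑ ^ 2) ≤ ENNReal.ofReal (A ^ 2) := by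
  obtain ⟨hd, hi, hgi⟩ := hu
  have hsum : Integrable fun y => gradNorm u y ^ 2 + u y ^ 2 := hgi.add hi
  have hbdd : BddAbove (Set.range fun c : Plane =>
      ∫ y in Metric.closedBall c 6, (gradNorm u y ^ 2 + u y ^ 2)) := by
    refine ⟨∫ y, (gradNorm u y ^ 2 + u y ^ 2), ?_⟩
    rintro _ ⟨c, rfl⟩
    exact setIntegral_le_integral hsum (Filter.Eventually.of_forall fun y => by positivity)
  have h1 : ∫ y in Metric.closedBall x 6, (gradNorm u y ^ 2 + u y ^ 2) ≤ A ^ 2 :=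
    (le_ciSup hbdd x).trans hloc
  have h2 : ∫⁻ y in Metric.ball x 1, ENNReal.ofReal (gradNorm u y ^ 2 + u y ^ 2) ≤
      ENNReal.ofReal (A ^ 2) := by
    refine (lintegral_mono_set (Metric.ball_subset_closedBall.trans
      (Metric.closedBall_subset_closedBall (by norm_num : (1:ℝ) ≤ 6)))).trans ?_
    rw [← ofReal_integral_eq_lintegral_ofReal hsum.integrableOn
      (Filter.Eventually.of_forall fun y => by positivity)]
    exact ENNReal.ofReal_le_ofReal h1
  constructor <;> refine (lintegral_mono fun y => ?_).trans h2
  · rw [← ofReal_norm, ← ENNReal.ofReal_pow (norm_nonneg _), Real.norm_eq_abs, sq_abs]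
    exact ENNReal.ofReal_le_ofReal (by nlinarith [sq_nonneg (gradNorm u y)])
  · rw [gradNorm_sq_enorm]
    exact ENNReal.ofReal_le_ofReal (by nlinarith [sq_nonneg (u y)])

/-- Weak-type Moser–Trudinger inequality with the sharp exponent. -/
theorem volume_superlevel_le_of_radius {u : Plane → ℝ} (hu : MemH1 u) {A : ℝ} (hA : 0 < A)
    (hA1 : A < 1) (hloc : H1locSq 6 u ≤ A ^ 2) {ρ : ℝ} (hρ : 0 < ρ) (hρ1 : ρ ≤ 1) {t : ℝ}
    (ht : 2 + A * √(Real.log (1 / ρ) / (2 * π)) ≤ t) :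
    volume {x | t ≤ |u x|} ≤ ENNReal.ofReal (ρ ^ 2 * ∫ x, gradNorm u x ^ 2) := by
  have hd := hu.1
  set G : Plane → ℝ≥0∞ := fun y => ‖fderiv ℝ u y‖ₑ with hGdef
  have hG : Measurable G := (measurable_fderiv ℝ u).enorm
  set N : Plane → ℝ≥0∞ := fun x =>
    ∫⁻ y in Metric.ball (0 : Plane) ρ, G (x + y) * ENNReal.ofReal ‖y‖⁻¹ with hN
  have hL : 0 ≤ Real.log (1 / ρ) := Real.log_nonneg (by rw [le_div_iff₀ hρ]; linarith)
  have hpi := Real.pi_pos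
  have hlow : ∀ x, t ≤ |u x| → ENNReal.ofReal (2 * π) ≤ N x := by
    intro x hx
    obtain ⟨hx1, hx2⟩ := setLIntegral_ball_le_of_H1locSq hu hloc x
    rw [← setLIntegral_ball_comp_add] at hx1 hx2
    have hA1' : (∫⁻ y in Metric.ball (0 : Plane) 1, ‖u (x + y)‖ₑ) ≤ ENNReal.ofReal (A * √π) := by
      have h := lintegral_mul_sq_le (volume.restrict (Metric.ball (0 : Plane) 1))
        (u := fun y => ‖u (x + y)‖ₑ) (v := fun _ => 1)
        ((hd.continuous.measurable.comp (measurable_const_add x)).enorm.aemeasurable) (by fun_prop)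
      rw [← ENNReal.pow_le_pow_left_iff two_ne_zero]
      simp only [mul_one, one_pow, lintegral_const, Measure.restrict_apply MeasurableSet.univ,
        Set.univ_inter, EuclideanSpace.volume_ball_fin_two, ENNReal.ofReal_one, one_mul] at h
      refine h.trans ((mul_le_mul_left hx1 _).trans_eq ?_)
      rw [← ENNReal.ofReal_pow (by positivity), mul_pow, Real.sq_sqrt hpi.le,
        ENNReal.ofReal_mul (by positivity)]
    have hfar : (∫⁻ y in Metric.ball (0 : Plane) 1 \ Metric.ball 0 ρ,
        G (x + y) * ENNReal.ofReal ‖y‖⁻¹) ≤ ENNReal.ofReal (A * √(2 * π * Real.log (1 / ρ))) := by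
      rw [← ENNReal.pow_le_pow_left_iff two_ne_zero]
      refine (sq_far_potential_le (hG.comp (measurable_const_add x)) hρ hρ1).trans
        ((mul_le_mul_left hx2 _).trans_eq ?_)
      rw [← ENNReal.ofReal_pow (by positivity), mul_pow, Real.sq_sqrt (by positivity),
        ENNReal.ofReal_mul (sq_nonneg A)]
    have hsplit : (∫⁻ y in Metric.ball (0 : Plane) 1, G (x + y) * ENNReal.ofReal ‖y‖⁻¹) ≤
        ENNReal.ofReal (A * √(2 * π * Real.log (1 / ρ))) + N x := by
      rw [← Set.sdiff_union_of_subset (Metric.ball_subset_ball hρ1)]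
      exact (lintegral_union_le _ _ _).trans (add_le_add hfar le_rfl)
    have hmain := (pi_mul_enorm_le_potential hd x).trans
      (add_le_add hA1' (mul_le_mul_right hsplit _))
    by_contra! hlt
    have hNt : N x ≠ ∞ := hlt.ne_top
    rw [← ENNReal.ofReal_toReal hNt, ENNReal.ofReal_lt_ofReal_iff (by positivity)] at hlt
    rw [← ENNReal.ofReal_toReal hNt, ← ofReal_norm, ← ENNReal.ofReal_mul hpi.le,
      ← ENNReal.ofReal_add (by positivity) (by positivity), ← ENNReal.ofReal_mul (by norm_num),
      ← ENNReal.ofReal_add (by positivity) (by positivity),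
      ENNReal.ofReal_le_ofReal_iff (by positivity), Real.norm_eq_abs] at hmain
    have e : √(2 * π * Real.log (1 / ρ)) = 2 * π * √(Real.log (1 / ρ) / (2 * π)) := by
      rw [← Real.sqrt_sq (show (0:ℝ) ≤ 2 * π by positivity), ← Real.sqrt_mul (by positivity),
        Real.sqrt_sq (by positivity)]
      congr 1
      field_simp
    rw [e] at hmain
    have hs : A * √π ≤ π := by
      have h3 : 1 ≤ √π := Real.one_le_sqrt.2 (by linarith [Real.pi_gt_three])
      have := Real.sq_sqrt hpi.le
      nlinarith
    have := mul_le_mul_of_nonneg_left (ht.trans hx) hpi.le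
    nlinarith
  have hcheb : ENNReal.ofReal (2 * π) ^ 2 * volume {x | t ≤ |u x|} ≤
      ENNReal.ofReal (2 * π * ρ) ^ 2 * ∫⁻ x, G x ^ 2 := by
    refine le_trans ?_ (lintegral_sq_near_potential_le hG hρ)
    have hms : MeasurableSet {x | t ≤ |u x|} :=
      measurableSet_le measurable_const (hd.continuous.measurable.norm)
    calc _ = ∫⁻ _ in {x | t ≤ |u x|}, ENNReal.ofReal (2 * π) ^ 2 := by simp
      _ ≤ ∫⁻ x in {x | t ≤ |u x|}, N x ^ 2 :=
        setLIntegral_mono' hms fun x hx => pow_le_pow_left₀ zero_le (hlow x hx) 2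
      _ ≤ _ := setLIntegral_le_lintegral _ _
  have hGi : ∫⁻ x, G x ^ 2 = ENNReal.ofReal (∫ x, gradNorm u x ^ 2) := by
    rw [ofReal_integral_eq_lintegral_ofReal hu.2.2
      (Filter.Eventually.of_forall fun y => by positivity)]
    exact lintegral_congr fun x => gradNorm_sq_enorm u x
  rw [hGi, ENNReal.ofReal_mul (p := 2 * π) (by positivity), mul_pow, mul_assoc,
    ENNReal.mul_le_mul_iff_right (pow_ne_zero 2 (ENNReal.ofReal_pos.2 (by positivity)).ne')
      (ENNReal.pow_ne_top ENNReal.ofReal_ne_top)] at hcheb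
  rwa [ENNReal.ofReal_mul (by positivity), ENNReal.ofReal_pow hρ.le]

theorem integral_gradNorm_sq_le_H1Sq (u : Plane → ℝ) : ∫ x, gradNorm u x ^ 2 ≤ H1Sq u :=
  le_add_of_nonneg_right (integral_nonneg fun _ => sq_nonneg _)

theorem integral_sq_le_H1Sq (u : Plane → ℝ) : ∫ x, u x ^ 2 ≤ H1Sq u :=
  le_add_of_nonneg_left (integral_nonneg fun _ => sq_nonneg _)

theorem H1Sq_nonneg (u : Plane → ℝ) : 0 ≤ H1Sq u :=
  add_nonneg (integral_nonneg fun _ => sq_nonneg _) (integral_nonneg fun _ => sq_nonneg _)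

theorem volume_superlevel_le_H1Sq {u : Plane → ℝ} (hu : MemH1 u) {t : ℝ} (ht : 1 ≤ t) :
    volume {x | t ≤ |u x|} ≤ ENNReal.ofReal (H1Sq u) := by
  have hms : MeasurableSet {x | t ≤ |u x|} :=
    measurableSet_le measurable_const hu.1.continuous.measurable.norm
  calc volume {x | t ≤ |u x|} = ∫⁻ _ in {x | t ≤ |u x|}, 1 := by simp
    _ ≤ ∫⁻ x in {x | t ≤ |u x|}, ENNReal.ofReal (u x ^ 2) := by
      refine setLIntegral_mono' hms fun x hx => ?_
      rw [← ENNReal.ofReal_one]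
      refine ENNReal.ofReal_le_ofReal ?_
      rw [← sq_abs]
      exact one_le_pow₀ (ht.trans hx)
    _ ≤ ∫⁻ x, ENNReal.ofReal (u x ^ 2) := setLIntegral_le_lintegral _ _
    _ = ENNReal.ofReal (∫ x, u x ^ 2) :=
      (ofReal_integral_eq_lintegral_ofReal hu.2.1
        (Filter.Eventually.of_forall fun y => sq_nonneg _)).symm
    _ ≤ _ := ENNReal.ofReal_le_ofReal (integral_sq_le_H1Sq u)

theorem exists_volume_superlevel_le {A γ : ℝ} (hA : 0 < A) (hA1 : A < 1) (hγ : 0 < γ)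
    (hγA : γ * A ^ 2 < 4 * π) :
    ∃ C : ℝ, 0 < C ∧ ∀ u : Plane → ℝ, MemH1 u → H1locSq 6 u ≤ A ^ 2 → ∀ t : ℝ, 1 ≤ t →
      volume {x | t ≤ |u x|} ≤ ENNReal.ofReal (C * Real.exp (-γ * t ^ 2) * H1Sq u) := by
  set b : ℝ := 4 * π / A ^ 2 with hb
  have hbγ : γ < b := by rw [hb, lt_div_iff₀ (by positivity)]; exact hγA
  have hd : 0 < b - γ := sub_pos.2 hbγ
  have hpi := Real.pi_pos
  refine ⟨Real.exp (4 * b ^ 2 / (b - γ) + 4 * γ), Real.exp_pos _, fun u hu hloc t ht => ?_⟩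
  have hH := H1Sq_nonneg u
  rw [← Real.exp_add]
  rcases le_total t 2 with h2 | h2
  · refine (volume_superlevel_le_H1Sq hu ht).trans (ENNReal.ofReal_le_ofReal ?_)
    refine le_mul_of_one_le_left hH (Real.one_le_exp ?_)
    have : 0 ≤ 4 * b ^ 2 / (b - γ) := by positivity
    have := mul_le_mul_of_nonneg_left (show t ^ 2 ≤ 4 by nlinarith) hγ.le
    linarith
  · set ρ : ℝ := Real.exp (-(2 * π * ((t - 2) / A) ^ 2)) with hρ
    have ht2 : 0 ≤ (t - 2) / A := div_nonneg (by linarith) hA.le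
    have hlog : Real.log (1 / ρ) / (2 * π) = ((t - 2) / A) ^ 2 := by
      rw [hρ, one_div, ← Real.exp_neg, Real.log_exp]
      field_simp
    have h := volume_superlevel_le_of_radius hu hA hA1 hloc (ρ := ρ) (Real.exp_pos _)
      (Real.exp_le_one_iff.2 (neg_nonpos.2 (by positivity))) (t := t) (by
        rw [hlog, Real.sqrt_sq ht2, mul_div_cancel₀ _ hA.ne']; linarith)
    refine h.trans (ENNReal.ofReal_le_ofReal ?_)
    refine mul_le_mul ?_ (integral_gradNorm_sq_le_H1Sq u)
      (integral_nonneg fun _ => sq_nonneg _) (Real.exp_pos _).le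
    rw [hρ, ← Real.exp_nat_mul]
    refine Real.exp_le_exp.2 ?_
    have e : ((2 : ℕ) : ℝ) * -(2 * π * ((t - 2) / A) ^ 2) = -(b * (t - 2) ^ 2) := by
      rw [hb]; field_simp; push_cast; ring
    rw [e]
    have e2 : 4 * b ^ 2 / (b - γ) + 4 * γ + -γ * t ^ 2 + b * (t - 2) ^ 2 =
        (b - γ) * (t - 2 * b / (b - γ)) ^ 2 + 4 * b + 4 * γ := by
      field_simp; ring
    have : 0 ≤ (b - γ) * (t - 2 * b / (b - γ)) ^ 2 := by positivity
    nlinarith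

theorem summable_exp_quadratic {β γ : ℝ} (h : β < γ) :
    Summable fun n : ℕ => Real.exp (β * ((n : ℝ) + 2) ^ 2 - γ * ((n : ℝ) + 1) ^ 2) := by
  set d := γ - β with hd
  have hd0 : 0 < d := sub_pos.2 h
  set K := (2 * |β| + 1) ^ 2 / (4 * d) + 3 * |β| + 1 with hK
  have hs : Summable fun n : ℕ => Real.exp K * Real.exp (-(n : ℝ)) :=
    Real.summable_exp_neg_nat.mul_left _
  refine Summable.of_nonneg_of_le (fun n => (Real.exp_pos _).le) (fun n => ?_) hs
  rw [← Real.exp_add]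
  refine Real.exp_le_exp.2 ?_
  have hn : (0:ℝ) ≤ n := n.cast_nonneg
  have hβ := le_abs_self β
  have hβ0 := abs_nonneg β
  have hsq : 0 ≤ d * (((n:ℝ) + 1) - (2 * |β| + 1) / (2 * d)) ^ 2 := by positivity
  have e : d * (((n:ℝ) + 1) - (2 * |β| + 1) / (2 * d)) ^ 2 =
      d * ((n:ℝ) + 1) ^ 2 - (2 * |β| + 1) * ((n:ℝ) + 1) + (2 * |β| + 1) ^ 2 / (4 * d) := by
    field_simp; ring
  rw [e] at hsq
  have e3 : β * ((n : ℝ) + 2) ^ 2 - γ * ((n : ℝ) + 1) ^ 2 =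
      -(d * ((n:ℝ) + 1) ^ 2) + β * (2 * n + 3) := by rw [hd]; ring
  rw [e3, hK]
  nlinarith [mul_le_mul_of_nonneg_right hβ (by positivity : (0:ℝ) ≤ 2 * n + 3)]

theorem exists_lintegral_exp_le {A β γ : ℝ} (hA : 0 < A) (hA1 : A < 1) (hβ : 0 < β) (hβγ : β < γ)
    (hγA : γ * A ^ 2 < 4 * π) :
    ∃ C : ℝ, 0 < C ∧ ∀ u : Plane → ℝ, MemH1 u → H1locSq 6 u ≤ A ^ 2 →
      ∫⁻ x in {x | 1 ≤ |u x|}, ENNReal.ofReal (Real.exp (β * u x ^ 2)) ≤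
        ENNReal.ofReal (C * H1Sq u) := by
  obtain ⟨C, hC, hvol⟩ := exists_volume_superlevel_le hA hA1 (hβ.trans hβγ) hγA
  have hsum := (summable_exp_quadratic hβγ).mul_left C
  set S := ∑' n : ℕ, C * Real.exp (β * ((n : ℝ) + 2) ^ 2 - γ * ((n : ℝ) + 1) ^ 2) with hS
  have hS0 : 0 ≤ S := tsum_nonneg fun n => by positivity
  refine ⟨S + 1, by positivity, fun u hu hloc => ?_⟩
  have hH := H1Sq_nonneg u
  have hmu : Measurable fun x => |u x| := hu.1.continuous.measurable.norm
  have hms : ∀ t : ℝ, MeasurableSet {x | t ≤ |u x|} := fun t => measurableSet_le measurable_const hmu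
  have hpt : ∀ x, {x | 1 ≤ |u x|}.indicator (fun x => ENNReal.ofReal (Real.exp (β * u x ^ 2))) x ≤
      ∑' n : ℕ, {x | (n:ℝ) + 1 ≤ |u x|}.indicator
        (fun _ => ENNReal.ofReal (Real.exp (β * ((n : ℝ) + 2) ^ 2))) x := by
    intro x
    by_cases hx : 1 ≤ |u x|
    · refine le_trans ?_ (ENNReal.le_tsum (⌊|u x| - 1⌋₊))
      have h0 : 0 ≤ |u x| - 1 := by linarith
      have h1 := Nat.floor_le h0
      have h2 := Nat.lt_floor_add_one (|u x| - 1)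
      rw [Set.indicator_of_mem (by exact hx), Set.indicator_of_mem (by
        simp only [Set.mem_ofPred_eq]; linarith)]
      refine ENNReal.ofReal_le_ofReal (Real.exp_le_exp.2 (mul_le_mul_of_nonneg_left ?_ hβ.le))
      rw [← sq_abs]
      exact pow_le_pow_left₀ (abs_nonneg _) (by linarith) 2
    · rw [Set.indicator_of_notMem (by exact hx)]; exact zero_le
  rw [← lintegral_indicator (hms 1)]
  refine (lintegral_mono hpt).trans ?_
  rw [lintegral_tsum fun n => (measurable_const.indicator (hms _)).aemeasurable]
  calc _ ≤ ∑' n : ℕ, ENNReal.ofReal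
        (C * Real.exp (β * ((n : ℝ) + 2) ^ 2 - γ * ((n : ℝ) + 1) ^ 2) * H1Sq u) := by
        refine ENNReal.tsum_le_tsum fun n => ?_
        rw [lintegral_indicator (hms _), setLIntegral_const]
        refine (mul_le_mul_right (hvol u hu hloc _ (by linarith [n.cast_nonneg (α := ℝ)])) _).trans_eq ?_
        rw [← ENNReal.ofReal_mul (Real.exp_pos _).le, sub_eq_add_neg, Real.exp_add]
        congr 1
        rw [← neg_mul]
        ring
    _ = ENNReal.ofReal (S * H1Sq u) := by
        rw [← ENNReal.ofReal_tsum_of_nonneg (fun n => by positivity) (hsum.mul_right _),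
          tsum_mul_right]
    _ ≤ _ := ENNReal.ofReal_le_ofReal (by nlinarith)

theorem exp_le_of_holder {C γ : ℝ} {u : Plane → ℝ}
    (hvol : ∀ t : ℝ, 1 ≤ t →
      volume {x | t ≤ |u x|} ≤ ENNReal.ofReal (C * Real.exp (-γ * t ^ 2) * H1Sq u))
    (hC : 0 < C) {α M : ℝ} (hα : 0 < α) (hM : 0 < M)
    (hhol : ∀ x y, |u x - u y| ≤ M * ‖x - y‖ ^ α) {x : Plane} (hx : 2 ≤ |u x|) :
    Real.exp (γ * (|u x| - 1) ^ 2) ≤ C * H1Sq u * M ^ (2 / α) := by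
  set r : ℝ := M ^ (-(1 / α)) with hr
  have hr0 : 0 < r := Real.rpow_pos_of_pos hM _
  have hrα : M * r ^ α = 1 := by
    rw [hr, ← Real.rpow_mul hM.le, neg_mul, one_div, inv_mul_cancel₀ hα.ne', Real.rpow_neg_one,
      mul_inv_cancel₀ hM.ne']
  have hsub : Metric.ball x r ⊆ {y | |u x| - 1 ≤ |u y|} := by
    intro y hy
    have h1 : ‖x - y‖ ^ α ≤ r ^ α := by
      refine Real.rpow_le_rpow (norm_nonneg _) ?_ hα.le
      rw [← dist_eq_norm, dist_comm]
      exact (Metric.mem_ball.1 hy).le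
    have h2 := (hhol x y).trans (mul_le_mul_of_nonneg_left h1 hM.le)
    rw [hrα] at h2
    have h3 := abs_sub_abs_le_abs_sub (u x) (u y)
    simp only [Set.mem_ofPred_eq]
    linarith
  have h := (measure_mono hsub).trans (hvol (|u x| - 1) (by linarith))
  have hH := H1Sq_nonneg u
  rw [EuclideanSpace.volume_ball_fin_two, ← ENNReal.ofReal_pow hr0.le,
    ← ENNReal.ofReal_mul (by positivity), ENNReal.ofReal_le_ofReal_iff (by positivity)] at h
  have hMr : M ^ (2 / α) * r ^ 2 = 1 := by
    rw [hr, ← Real.rpow_natCast, ← Real.rpow_mul hM.le, ← Real.rpow_add hM]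
    rw [show 2 / α + -(1 / α) * ((2 : ℕ) : ℝ) = 0 by push_cast; ring, Real.rpow_zero]
  have hexp : Real.exp (-γ * (|u x| - 1) ^ 2) * Real.exp (γ * (|u x| - 1) ^ 2) = 1 := by
    rw [← Real.exp_add]; simp
  have hMp : 0 < M ^ (2 / α) := Real.rpow_pos_of_pos hM _
  have h4 : r ^ 2 ≤ C * Real.exp (-γ * (|u x| - 1) ^ 2) * H1Sq u := by
    nlinarith [Real.pi_gt_three, sq_nonneg r]
  have h5 := mul_le_mul_of_nonneg_left h4
    (mul_pos hMp (Real.exp_pos (γ * (|u x| - 1) ^ 2))).le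
  calc Real.exp (γ * (|u x| - 1) ^ 2)
      = M ^ (2 / α) * r ^ 2 * Real.exp (γ * (|u x| - 1) ^ 2) := by rw [hMr, one_mul]
    _ ≤ C * H1Sq u * M ^ (2 / α) *
          (Real.exp (-γ * (|u x| - 1) ^ 2) * Real.exp (γ * (|u x| - 1) ^ 2)) := by linarith
    _ = _ := by rw [hexp, mul_one]

/-- A majorant of the derivative of `f`, monotone in the absolute value of its argument. -/
def fWeight (s : ℝ) : ℝ := 3 * (4 * π * s ^ 2) ^ 2 * Real.exp (4 * π * s ^ 2)

theorem fWeight_nonneg (s : ℝ) : 0 ≤ fWeight s := by unfold fWeight; positivity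

theorem continuous_fWeight : Continuous fWeight := by unfold fWeight; fun_prop

theorem fWeight_le_of_abs_le {a b : ℝ} (h : |a| ≤ |b|) : fWeight a ≤ fWeight b := by
  have hpi := Real.pi_pos
  have : a ^ 2 ≤ b ^ 2 := sq_le_sq.2 h
  unfold fWeight
  gcongr

theorem hasDerivAt_f (s : ℝ) :
    HasDerivAt f (2 * (4 * π * s ^ 2) * (Real.exp (4 * π * s ^ 2) - 1) +
      (Real.exp (4 * π * s ^ 2) - 1 - 4 * π * s ^ 2)) s := by
  have h1 : HasDerivAt (fun s : ℝ => 4 * π * s ^ 2) (4 * π * (2 * s)) s := by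
    simpa using (hasDerivAt_pow 2 s).const_mul (4 * π)
  have h := ((h1.exp.sub_const 1).sub h1).mul (hasDerivAt_id s)
  refine HasDerivAt.congr_deriv h ?_
  simp only [id, Pi.sub_apply]
  ring

theorem deriv_f_bound (s : ℝ) :
    ‖2 * (4 * π * s ^ 2) * (Real.exp (4 * π * s ^ 2) - 1) +
      (Real.exp (4 * π * s ^ 2) - 1 - 4 * π * s ^ 2)‖ ≤ fWeight s := by
  unfold fWeight
  have hx : 0 ≤ 4 * π * s ^ 2 := by have := Real.pi_pos; positivity
  set x := 4 * π * s ^ 2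
  have h1 : Real.exp x - 1 ≤ x * Real.exp x := by
    have h := mul_le_mul_of_nonneg_right (Real.add_one_le_exp (-x)) (Real.exp_pos x).le
    rw [← Real.exp_add] at h
    simp at h
    linarith
  have h2 := Real.add_one_le_exp x
  rw [Real.norm_of_nonneg (by nlinarith)]
  nlinarith [mul_le_mul_of_nonneg_left h1 hx]

theorem abs_f_sub_le (a b : ℝ) : |f b - f a| ≤ |b - a| * (fWeight a + fWeight b) := by
  rw [mul_comm]
  refine (convex_uIcc a b).norm_image_sub_le_of_norm_hasDerivWithin_le
    (fun s _ => (hasDerivAt_f s).hasDerivWithinAt) (fun s hs => (deriv_f_bound s).trans ?_)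
    Set.left_mem_uIcc Set.right_mem_uIcc
  have h : |s| ≤ max |a| |b| := by
    rcases le_total a b with hab | hab
    · rw [Set.uIcc_of_le hab] at hs
      exact abs_le_max_abs_abs hs.1 hs.2
    · rw [Set.uIcc_of_ge hab] at hs
      rw [max_comm]
      exact abs_le_max_abs_abs hs.1 hs.2
  rcases le_max_iff.1 h with h | h
  · exact (fWeight_le_of_abs_le h).trans (le_add_of_nonneg_right (fWeight_nonneg b))
  · exact (fWeight_le_of_abs_le h).trans (le_add_of_nonneg_left (fWeight_nonneg a))

theorem fWeight_rpow_le_of_abs_lt_two {p : ℝ} (hp : 0 ≤ p) {s : ℝ} (hs : |s| < 2) :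
    fWeight s ^ p ≤ (48 * π ^ 2 * Real.exp (16 * π)) ^ p * |s| ^ (4 * p) := by
  have hpi := Real.pi_pos
  have e : |s| ^ (4 * p) = (|s| ^ 4) ^ p := by
    rw [Real.rpow_mul (abs_nonneg s)]; norm_cast
  rw [e, ← Real.mul_rpow (by positivity) (by positivity)]
  refine Real.rpow_le_rpow (fWeight_nonneg s) ?_ hp
  have h4 : s ^ 2 ≤ 4 := by
    rw [← sq_abs]; nlinarith [abs_nonneg s]
  have h1 : Real.exp (4 * π * s ^ 2) ≤ Real.exp (16 * π) := Real.exp_le_exp.2 (by nlinarith)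
  have e2 : |s| ^ 4 = s ^ 4 := by rw [show 4 = 2 * 2 by norm_num, pow_mul, pow_mul, sq_abs]
  rw [e2]
  unfold fWeight
  calc 3 * (4 * π * s ^ 2) ^ 2 * Real.exp (4 * π * s ^ 2)
      ≤ 3 * (4 * π * s ^ 2) ^ 2 * Real.exp (16 * π) := by gcongr
    _ = _ := by ring

theorem fWeight_rpow_le_exp {p ε κ : ℝ} (hp : 0 ≤ p) (hε : 0 < ε)
    (hκ : p * ((1 + ε) * (4 * π)) ≤ κ) (s : ℝ) :
    fWeight s ^ p ≤ (6 / ε ^ 2) ^ p * Real.exp (κ * s ^ 2) := by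
  have hx : 0 ≤ 4 * π * s ^ 2 := by have := Real.pi_pos; positivity
  have h1 : fWeight s ≤ 6 / ε ^ 2 * Real.exp ((1 + ε) * (4 * π * s ^ 2)) := by
    unfold fWeight
    set x := 4 * π * s ^ 2
    have h := Real.quadratic_le_exp_of_nonneg (mul_nonneg hε.le hx)
    have h2 : 3 * x ^ 2 ≤ 6 / ε ^ 2 * Real.exp (ε * x) := by
      rw [div_mul_eq_mul_div, le_div_iff₀ (by positivity)]
      nlinarith [mul_nonneg hε.le hx]
    rw [add_mul, one_mul, add_comm, Real.exp_add, ← mul_assoc]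
    gcongr
  calc fWeight s ^ p ≤ (6 / ε ^ 2 * Real.exp ((1 + ε) * (4 * π * s ^ 2))) ^ p :=
        Real.rpow_le_rpow (fWeight_nonneg s) h1 hp
    _ = (6 / ε ^ 2) ^ p * Real.exp (p * ((1 + ε) * (4 * π)) * s ^ 2) := by
        rw [Real.mul_rpow (by positivity) (Real.exp_pos _).le, ← Real.exp_mul]
        congr 2; ring
    _ ≤ _ := by gcongr

theorem exp_sq_le_rpow {γ q c : ℝ} (hγ : 0 ≤ q * γ) (h : c < q * γ) (s : ℝ) :
    Real.exp (c * s ^ 2) ≤ Real.exp ((q * γ) ^ 2 / (q * γ - c)) *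
      Real.exp (γ * (|s| - 1) ^ 2) ^ q := by
  rw [← Real.exp_mul, ← Real.exp_add]
  refine Real.exp_le_exp.2 ?_
  rw [show γ * (|s| - 1) ^ 2 * q = q * γ * (|s| - 1) ^ 2 by ring, ← sq_abs s]
  set a := q * γ
  have hd : 0 < a - c := sub_pos.2 h
  have e : (a - c) * (|s| - a / (a - c)) ^ 2 =
      (a - c) * |s| ^ 2 - 2 * a * |s| + a ^ 2 / (a - c) := by field_simp; ring
  have h0 : 0 ≤ (a - c) * (|s| - a / (a - c)) ^ 2 := by positivity
  nlinarith

theorem lintegral_fWeight_small_le {p : ℝ} (hp : 2 ≤ p) {u : Plane → ℝ} (hu : Continuous u)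
    {M : ℝ} (hM : ∀ x, |u x| ≤ M) (hi : Integrable fun x => |u x| ^ (8:ℝ))
    (hi8 : ∫ x, |u x| ^ (8:ℝ) ≤ M ^ (8:ℝ)) :
    ∫⁻ x in {x | |u x| < 2}, ENNReal.ofReal (fWeight (u x) ^ p) ≤
      ENNReal.ofReal ((48 * π ^ 2 * Real.exp (16 * π)) ^ p * M ^ (4 * p)) := by
  have hM0 : 0 ≤ M := (abs_nonneg _).trans (hM 0)
  set K := (48 * π ^ 2 * Real.exp (16 * π)) ^ p with hK
  have hK0 : 0 ≤ K := by positivity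
  have hms : MeasurableSet {x | |u x| < 2} :=
    measurableSet_lt hu.measurable.norm measurable_const
  have e : ∀ r : ℝ, 0 ≤ r → r ^ (4 * p) = r ^ (4 * p - 8) * r ^ (8:ℝ) := fun r hr => by
    rw [← Real.rpow_add_of_nonneg hr (by linarith) (by norm_num)]; congr 1; ring
  calc _ ≤ ∫⁻ x in {x | |u x| < 2}, ENNReal.ofReal (K * M ^ (4 * p - 8) * |u x| ^ (8:ℝ)) := by
        refine setLIntegral_mono' hms fun x hx => ENNReal.ofReal_le_ofReal ?_
        refine (fWeight_rpow_le_of_abs_lt_two (by linarith) hx).trans ?_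
        rw [e _ (abs_nonneg _), ← mul_assoc]
        gcongr
        · linarith
        · exact hM x
    _ ≤ ∫⁻ x, ENNReal.ofReal (K * M ^ (4 * p - 8) * |u x| ^ (8:ℝ)) :=
        setLIntegral_le_lintegral _ _
    _ = ENNReal.ofReal (K * M ^ (4 * p - 8) * ∫ x, |u x| ^ (8:ℝ)) := by
        rw [← ofReal_integral_eq_lintegral_ofReal (hi.const_mul _)
          (Filter.Eventually.of_forall fun y => by positivity), integral_const_mul]
    _ ≤ _ := by
        refine ENNReal.ofReal_le_ofReal ?_
        rw [e _ hM0, ← mul_assoc]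
        gcongr

theorem exists_exponents {A : ℝ} (hA : 0 < A) (hA1 : A < 1) :
    ∃ δ ∈ Set.Ioo (0:ℝ) (1/8), ∃ ε β γ : ℝ, 0 < ε ∧ 0 < β ∧ β < γ ∧ γ * A ^ 2 < 4 * π ∧
      2 / (1 - δ) * ((1 + ε) * (4 * π)) ≤ 4 * π + β ∧
      4 * π < (1 - 4 * δ) / (1 - δ) * γ := by
  have hpi := Real.pi_pos
  have hA2 : 0 < 1 / A ^ 2 - 1 := by
    rw [sub_pos, lt_div_iff₀ (by positivity)]; nlinarith
  set τ := min 1 ((1 / A ^ 2 - 1) / 4) with hτ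
  have hτ0 : 0 < τ := lt_min one_pos (by positivity)
  have hτ1 : τ ≤ 1 := min_le_left _ _
  have hτA : (1 + 4 * τ) * A ^ 2 ≤ 1 := by
    have : 1 + 4 * τ ≤ 1 / A ^ 2 := by linarith [min_le_right 1 ((1 / A ^ 2 - 1) / 4)]
    rwa [le_div_iff₀ (by positivity)] at this
  refine ⟨τ / 100, ⟨by positivity, by linarith⟩, τ / 2, 4 * π * (1 + 2 * τ), 4 * π * (1 + 3 * τ),
    by positivity, by positivity, by nlinarith, ?_, ?_, ?_⟩
  · have : 0 < τ * A ^ 2 := by positivity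
    nlinarith
  · rw [div_mul_eq_mul_div, div_le_iff₀ (by linarith)]
    nlinarith [mul_pos hpi hτ0, mul_nonneg (mul_pos hpi hτ0).le (sub_nonneg.2 hτ1)]
  · rw [div_mul_eq_mul_div, lt_div_iff₀ (by linarith)]
    nlinarith [mul_pos hpi hτ0, mul_nonneg (mul_pos hpi hτ0).le (sub_nonneg.2 hτ1)]

theorem exists_lintegral_fWeight_le {A : ℝ} (hA : 0 < A) (hA1 : A < 1) :
    ∃ δ ∈ Set.Ioo (0:ℝ) (1/8), ∃ C : ℝ, 0 ≤ C ∧ ∀ (u : Plane → ℝ) (M h : ℝ),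
      MemH1 u → H1locSq 6 u ≤ A ^ 2 → H1Sq u ≤ h ^ 2 → (∀ x, |u x| ≤ M) →
      (∀ x y, |u x - u y| ≤ M * ‖x - y‖ ^ (1/4 - δ)) →
      Integrable (fun x => |u x| ^ (8:ℝ)) → ∫ x, |u x| ^ (8:ℝ) ≤ M ^ (8:ℝ) →
      ∫⁻ x, ENNReal.ofReal (fWeight (u x) ^ (2 / (1 - δ))) ≤
        ENNReal.ofReal (C * (1 + h ^ 2) ^ 2 * M ^ (4 * (2 / (1 - δ)))) := by
  obtain ⟨δ, hδ, ε, β, γ, hε, hβ, hβγ, hγA, hκ, hq⟩ := exists_exponents hA hA1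
  have hδ0 := hδ.1
  have hδ1 := hδ.2
  have h1δ : 0 < 1 - δ := by linarith
  set p := 2 / (1 - δ) with hp
  set q := (1 - 4 * δ) / (1 - δ) with hqdef
  have hp2 : 2 ≤ p := by rw [hp, le_div_iff₀ h1δ]; linarith
  have hq0 : 0 < q := div_pos (by linarith) h1δ
  have hq1 : q ≤ 1 := by rw [hqdef, div_le_one h1δ]; linarith
  have hα : 0 < 1 / 4 - δ := by linarith
  obtain ⟨C₀, hC₀, hvol⟩ := exists_volume_superlevel_le hA hA1 (hβ.trans hβγ) hγA
  obtain ⟨C₃, hC₃, hexp⟩ := exists_lintegral_exp_le hA hA1 hβ hβγ hγA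
  set K := (48 * π ^ 2 * Real.exp (16 * π)) ^ p with hK
  have hK0 : 0 ≤ K := by positivity
  set C₁ := (6 / ε ^ 2) ^ p with hC₁
  have hC₁0 : 0 ≤ C₁ := by positivity
  set C₂ := Real.exp ((q * γ) ^ 2 / (q * γ - 4 * π)) with hC₂
  have hC₂0 : 0 < C₂ := Real.exp_pos _
  refine ⟨δ, hδ, K + C₁ * C₂ * C₀ ^ q * C₃, by positivity,
    fun u M h hu hloc hH hM hhol hi hi8 => ?_⟩
  have hM0 : 0 ≤ M := (abs_nonneg _).trans (hM 0)
  have hH0 := H1Sq_nonneg u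
  have hms : MeasurableSet {x | |u x| < 2} :=
    measurableSet_lt hu.1.continuous.measurable.norm measurable_const
  set D := C₁ * C₂ * C₀ ^ q * (1 + h ^ 2) * M ^ (4 * p) with hD
  have hD0 : 0 ≤ D := by positivity
  have hlarge : ∫⁻ x in {x | |u x| < 2}ᶜ, ENNReal.ofReal (fWeight (u x) ^ p) ≤
      ENNReal.ofReal (D * (C₃ * h ^ 2)) := by
    calc _ ≤ ∫⁻ x in {x | |u x| < 2}ᶜ, ENNReal.ofReal D * ENNReal.ofReal (Real.exp (β * u x ^ 2)) := by
          refine setLIntegral_mono' hms.compl fun x hx => ?_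
          rw [← ENNReal.ofReal_mul hD0]
          refine ENNReal.ofReal_le_ofReal ?_
          have hx2 : 2 ≤ |u x| := not_lt.1 hx
          have hMpos : 0 < M := by linarith [hM x]
          have h1 := exp_le_of_holder (hvol u hu hloc) hC₀ hα hMpos hhol hx2
          have h2 : Real.exp (4 * π * u x ^ 2) ≤ C₂ * (C₀ ^ q * (1 + h ^ 2) * M ^ (4 * p)) := by
            refine (exp_sq_le_rpow (mul_pos hq0 (hβ.trans hβγ)).le hq (u x)).trans (mul_le_mul_of_nonneg_left ?_ hC₂0.le)
            refine (Real.rpow_le_rpow (Real.exp_pos _).le h1 hq0.le).trans ?_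
            have e : (M ^ (2 / (1 / 4 - δ))) ^ q = M ^ (4 * p) := by
              rw [← Real.rpow_mul hM0]
              congr 1
              rw [hqdef, hp]
              have : 1 - δ * 4 ≠ 0 := by linarith
              have : 1 - 4 * δ ≠ 0 := by linarith
              field_simp
            rw [Real.mul_rpow (by positivity) (by positivity), Real.mul_rpow hC₀.le hH0, e]
            gcongr
            calc H1Sq u ^ q ≤ (1 + h ^ 2) ^ q :=
                  Real.rpow_le_rpow hH0 (by linarith) hq0.le
              _ ≤ (1 + h ^ 2) ^ (1:ℝ) :=
                  Real.rpow_le_rpow_of_exponent_le (by nlinarith [sq_nonneg h]) hq1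
              _ = _ := Real.rpow_one _
          calc fWeight (u x) ^ p ≤ C₁ * Real.exp ((4 * π + β) * u x ^ 2) :=
                fWeight_rpow_le_exp (by linarith) hε hκ (u x)
            _ = C₁ * Real.exp (4 * π * u x ^ 2) * Real.exp (β * u x ^ 2) := by
                rw [add_mul, Real.exp_add]; ring
            _ ≤ C₁ * (C₂ * (C₀ ^ q * (1 + h ^ 2) * M ^ (4 * p))) * Real.exp (β * u x ^ 2) := by
                gcongr
            _ = _ := by rw [hD]; ring
      _ ≤ ∫⁻ x in {x | 1 ≤ |u x|}, ENNReal.ofReal D * ENNReal.ofReal (Real.exp (β * u x ^ 2)) := by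
          refine lintegral_mono_set fun x hx => ?_
          have hx2 : 2 ≤ |u x| := not_lt.1 hx
          simp only [Set.mem_ofPred_eq]
          linarith
      _ ≤ ENNReal.ofReal D * ENNReal.ofReal (C₃ * H1Sq u) := by
          rw [lintegral_const_mul' _ _ ENNReal.ofReal_ne_top]
          exact mul_le_mul_right (hexp u hu hloc) _
      _ ≤ _ := by
          rw [← ENNReal.ofReal_mul hD0]
          refine ENNReal.ofReal_le_ofReal ?_
          gcongr
  rw [← lintegral_add_compl _ hms]
  refine (add_le_add (lintegral_fWeight_small_le hp2 hu.1.continuous hM hi hi8) hlarge).trans ?_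
  rw [← ENNReal.ofReal_add (by positivity) (by positivity)]
  refine ENNReal.ofReal_le_ofReal ?_
  have hMp : 0 ≤ M ^ (4 * p) := by positivity
  have e1 : K * M ^ (4 * p) ≤ K * (1 + h ^ 2) ^ 2 * M ^ (4 * p) := by
    gcongr
    exact le_mul_of_one_le_right hK0 (one_le_pow₀ (by nlinarith [sq_nonneg h]))
  have e2 : D * (C₃ * h ^ 2) ≤ C₁ * C₂ * C₀ ^ q * C₃ * (1 + h ^ 2) ^ 2 * M ^ (4 * p) := by
    have : D * (C₃ * h ^ 2) ≤ D * (C₃ * (1 + h ^ 2)) := by gcongr; linarith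
    refine this.trans_eq ?_
    rw [hD]; ring
  linarith

theorem bddAbove_range_abs {u : Plane → ℝ} (hu : MemH1 u) {α : ℝ} (hα : 0 < α)
    (hh : IsHolder α u) : BddAbove (Set.range fun x => |u x|) := by
  obtain ⟨C, hC, hhol⟩ := hh
  refine ⟨1 + (2 * C ^ 2 + ∫ y, u y ^ 2), ?_⟩
  rintro _ ⟨x, rfl⟩
  have hπ := Real.pi_gt_three
  have hv : (volume : Measure Plane).real (Metric.ball x 1) = π := by
    simp [Measure.real, EuclideanSpace.volume_ball_fin_two, Real.pi_pos.le]
  have hc : Integrable (fun _ : Plane => 2 * C ^ 2) (volume.restrict (Metric.ball x 1)) :=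
    integrableOn_const (by simp [EuclideanSpace.volume_ball_fin_two])
  have hq : Integrable (fun y => 2 * u y ^ 2) (volume.restrict (Metric.ball x 1)) :=
    (hu.2.1.const_mul 2).integrableOn
  have h1 : ∫ _ in Metric.ball x 1, u x ^ 2 ≤ ∫ y in Metric.ball x 1, (2 * C ^ 2 + 2 * u y ^ 2) := by
    refine setIntegral_mono_on (integrableOn_const (by simp [EuclideanSpace.volume_ball_fin_two]))
      (hc.add hq) measurableSet_ball fun y hy => ?_
    have h2 : ‖x - y‖ ^ α ≤ 1 := by
      refine Real.rpow_le_one (norm_nonneg _) ?_ hα.le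
      rw [← dist_eq_norm, dist_comm]
      exact (Metric.mem_ball.1 hy).le
    have h3 : |u x - u y| ≤ C := (hhol x y).trans (mul_le_of_le_one_right hC h2)
    have h4 : (u x - u y) ^ 2 ≤ C ^ 2 := sq_le_sq' (abs_le.1 h3).1 (abs_le.1 h3).2
    nlinarith [sq_nonneg (u x - 2 * u y)]
  rw [integral_add hc hq] at h1
  simp only [setIntegral_const, hv, smul_eq_mul, integral_const_mul] at h1
  have h5 : ∫ y in Metric.ball x 1, u y ^ 2 ≤ ∫ y, u y ^ 2 :=
    setIntegral_le_integral hu.2.1 (Filter.Eventually.of_forall fun y => sq_nonneg _)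
  have h6 : 0 ≤ ∫ y, u y ^ 2 := integral_nonneg fun y => sq_nonneg _
  have h7 : u x ^ 2 ≤ 2 * C ^ 2 + ∫ y, u y ^ 2 := by
    by_contra! hlt
    nlinarith [mul_lt_mul_of_pos_left hlt Real.pi_pos, mul_nonneg (sub_pos.2 hπ).le h6]
  rw [← sq_abs] at h7
  dsimp only
  nlinarith [sq_nonneg (|u x| - 1), abs_nonneg (u x)]

theorem supNorm_nonneg (u : Plane → ℝ) : 0 ≤ supNorm u := Real.iSup_nonneg fun _ => abs_nonneg _

theorem holderSemi_nonneg (α : ℝ) (u : Plane → ℝ) : 0 ≤ holderSemi α u :=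
  Real.iSup_nonneg fun p => by split_ifs <;> positivity

theorem LpNorm_nonneg (p : ℝ) (u : Plane → ℝ) : 0 ≤ LpNorm p u :=
  Real.rpow_nonneg (integral_nonneg fun _ => by positivity) _

theorem abs_sub_le_holderSemi {u : Plane → ℝ} {α : ℝ} (hα : 0 < α) (hh : IsHolder α u)
    (x y : Plane) : |u x - u y| ≤ holderSemi α u * ‖x - y‖ ^ α := by
  obtain ⟨C, hC, hhol⟩ := hh
  rcases eq_or_ne x y with rfl | hxy
  · simp [Real.zero_rpow hα.ne']
  have hpos : ∀ {x y : Plane}, x ≠ y → 0 < ‖x - y‖ ^ α := fun h =>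
    Real.rpow_pos_of_pos (norm_pos_iff.2 (sub_ne_zero.2 h)) _
  have hbdd : BddAbove (Set.range fun p : Plane × Plane =>
      if p.1 = p.2 then 0 else |u p.1 - u p.2| / ‖p.1 - p.2‖ ^ α) := by
    refine ⟨C, ?_⟩
    rintro _ ⟨p, rfl⟩
    dsimp only
    split_ifs with h
    · exact hC
    · exact (div_le_iff₀ (hpos h)).2 (hhol _ _)
  have h := le_ciSup hbdd (x, y)
  simp only [hxy, if_false] at h
  exact (div_le_iff₀ (hpos hxy)).1 h

theorem integral_rpow_eq_LpNorm_rpow {p : ℝ} (hp : 0 < p) (u : Plane → ℝ) :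
    ∫ x, |u x| ^ p = LpNorm p u ^ p := by
  rw [LpNorm, ← Real.rpow_mul (integral_nonneg fun _ => by positivity), one_div,
    inv_mul_cancel₀ hp.ne', Real.rpow_one]

theorem memLp_of_integrable_rpow {p : ℝ} (hp : 0 < p) {w : Plane → ℝ} (hw : Continuous w)
    (hi : Integrable fun x => |w x| ^ p) : MemLp w (ENNReal.ofReal p) := by
  rw [← integrable_norm_rpow_iff hw.aestronglyMeasurable (by simpa using hp) ENNReal.ofReal_ne_top,
    ENNReal.toReal_ofReal hp.le]
  exact hi

theorem add_rpow_le_two_rpow_mul {a b p : ℝ} (ha : 0 ≤ a) (hb : 0 ≤ b) (hp : 0 ≤ p) :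
    (a + b) ^ p ≤ 2 ^ p * (a ^ p + b ^ p) := by
  calc (a + b) ^ p ≤ (2 * max a b) ^ p :=
        Real.rpow_le_rpow (by positivity)
          (by linarith [le_max_left a b, le_max_right a b]) hp
    _ = 2 ^ p * max a b ^ p := Real.mul_rpow zero_le_two (le_max_of_le_left ha)
    _ ≤ _ := by
        gcongr
        rcases max_choice a b with h | h <;> rw [h]
        · exact le_add_of_nonneg_right (by positivity)
        · exact le_add_of_nonneg_left (by positivity)

/-- Hölder's inequality `‖v‖₂ ≤ ‖D‖_{2/δ} ‖W‖_{2/(1-δ)}` for `|v| ≤ |D| W`. -/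
theorem LpNorm_two_le {δ : ℝ} (hδ : 0 < δ) (hδ1 : δ < 1) {v D W : Plane → ℝ} (hD : Continuous D)
    (hW : Continuous W) (hW0 : ∀ x, 0 ≤ W x) (hv : ∀ x, |v x| ≤ |D x| * W x)
    (hDi : Integrable fun x => |D x| ^ (2 / δ))
    (hWi : Integrable fun x => W x ^ (2 / (1 - δ))) :
    LpNorm 2 v ≤ (∫ x, W x ^ (2 / (1 - δ))) ^ (1 / (2 / (1 - δ))) * LpNorm (2 / δ) D := by
  have h1δ : 0 < 1 - δ := by linarith
  have hpq : (1 / δ).HolderConjugate (1 / (1 - δ)) := by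
    rw [Real.holderConjugate_iff]
    refine ⟨by rw [lt_div_iff₀ hδ]; linarith, by simp⟩
  have hDe : ∀ x, (|D x| ^ 2) ^ (1 / δ) = |D x| ^ (2 / δ) := fun x => by
    rw [← Real.rpow_natCast, ← Real.rpow_mul (abs_nonneg _)]; congr 1; push_cast; ring
  have hWe : ∀ x, (W x ^ 2) ^ (1 / (1 - δ)) = W x ^ (2 / (1 - δ)) := fun x => by
    rw [← Real.rpow_natCast, ← Real.rpow_mul (hW0 x)]; congr 1; push_cast; ring
  have hD2 : MemLp (fun x => |D x| ^ 2) (ENNReal.ofReal (1 / δ)) :=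
    memLp_of_integrable_rpow (by positivity) (by fun_prop) (by
      simpa only [abs_pow, abs_abs, hDe] using hDi)
  have hW2 : MemLp (fun x => W x ^ 2) (ENNReal.ofReal (1 / (1 - δ))) :=
    memLp_of_integrable_rpow (by positivity) (by fun_prop) (by
      simpa only [abs_pow, abs_of_nonneg (hW0 _), hWe] using hWi)
  have hH := integral_mul_le_Lp_mul_Lq_of_nonneg (μ := volume) hpq
    (Filter.Eventually.of_forall fun x => by positivity)
    (Filter.Eventually.of_forall fun x => by positivity) hD2 hW2
  simp only [hDe, hWe] at hH
  have : ENNReal.HolderTriple (ENNReal.ofReal (1 / δ)) (ENNReal.ofReal (1 / (1 - δ))) 1 :=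
    hpq.ennrealOfReal
  have hprod : Integrable fun x => |D x| ^ 2 * W x ^ 2 := by
    exact memLp_one_iff_integrable.1 (MemLp.mul hW2 hD2)
  have hle : ∫ x, |v x| ^ (2:ℝ) ≤ ∫ x, |D x| ^ 2 * W x ^ 2 := by
    refine integral_mono_of_nonneg (Filter.Eventually.of_forall fun x => by positivity) hprod
      (Filter.Eventually.of_forall fun x => ?_)
    simp only [Real.rpow_two, ← mul_pow]
    exact pow_le_pow_left₀ (abs_nonneg _) (hv x) 2
  have hI1 : 0 ≤ ∫ x, |D x| ^ (2 / δ) := integral_nonneg fun x => by positivity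
  have hI2 : 0 ≤ ∫ x, W x ^ (2 / (1 - δ)) := integral_nonneg fun x => by
    have := hW0 x; positivity
  calc LpNorm 2 v ≤ ((∫ x, |D x| ^ (2 / δ)) ^ (1 / (1 / δ)) *
        (∫ x, W x ^ (2 / (1 - δ))) ^ (1 / (1 / (1 - δ)))) ^ (1 / (2:ℝ)) :=
        Real.rpow_le_rpow (integral_nonneg fun x => by positivity) (hle.trans hH) (by norm_num)
    _ = _ := by
        rw [Real.mul_rpow (by positivity) (by positivity), ← Real.rpow_mul hI1, ← Real.rpow_mul hI2,
          mul_comm, LpNorm]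
        congr 2 <;> field_simp

/-- uniform local estimate on the nonlinearity (Lemma 3.1). -/
theorem statement0 (A : ℝ) (hA : A ∈ Set.Ioo (0:ℝ) 1) :
    ∃ δ ∈ Set.Ioo (0:ℝ) (1/8), ∃ C : ℝ → ℝ,
      ContinuousOn C (Set.Ici 0) ∧ MonotoneOn C (Set.Ici 0) ∧
      Set.MapsTo C (Set.Ici 0) (Set.Ici 0) ∧
      ∀ φ₀ φ₁ : Plane → ℝ,
        MemH1 φ₀ → MemH1 φ₁ →
        IsHolder (1/4 - δ) φ₀ → IsHolder (1/4 - δ) φ₁ →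
        Integrable (fun x => |φ₀ x| ^ (8:ℝ)) → Integrable (fun x => |φ₁ x| ^ (8:ℝ)) →
        Integrable (fun x => |φ₀ x| ^ (2/δ)) → Integrable (fun x => |φ₁ x| ^ (2/δ)) →
        H1locSq 6 φ₀ ≤ A ^ 2 → H1locSq 6 φ₁ ≤ A ^ 2 →
        LpNorm 2 (fun x => f (φ₁ x) - f (φ₀ x)) ≤
          C (max (Real.sqrt (H1Sq φ₀)) (Real.sqrt (H1Sq φ₁))) *
            (max (holderNorm (1/4 - δ) φ₀ + LpNorm 8 φ₀)
                 (holderNorm (1/4 - δ) φ₁ + LpNorm 8 φ₁)) ^ 4 *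
            LpNorm (2/δ) (fun x => φ₁ x - φ₀ x) := by
  obtain ⟨δ, hδ, C, hC, hmain⟩ := exists_lintegral_fWeight_le hA.1 hA.2
  have hδ0 := hδ.1
  have hδ1 := hδ.2
  have h1δ : 0 < 1 - δ := by linarith
  have hα : 0 < 1 / 4 - δ := by linarith
  set p := 2 / (1 - δ) with hp
  have hp0 : 0 < p := by positivity
  refine ⟨δ, hδ, fun h => (2 ^ p * (2 * (C * (1 + h ^ 2) ^ 2))) ^ (1 / p), ?_, ?_, ?_, ?_⟩
  · exact (Continuous.rpow_const (by fun_prop) fun _ => Or.inr (by positivity)).continuousOn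
  · intro a ha b hb hab
    have ha0 : 0 ≤ a := ha
    dsimp only
    gcongr
  · intro a ha
    exact Set.mem_Ici.2 (by positivity)
  intro φ₀ φ₁ hφ₀ hφ₁ hh₀ hh₁ h8₀ h8₁ hδi₀ hδi₁ hl₀ hl₁
  set h := max (Real.sqrt (H1Sq φ₀)) (Real.sqrt (H1Sq φ₁))
  set M := max (holderNorm (1/4 - δ) φ₀ + LpNorm 8 φ₀) (holderNorm (1/4 - δ) φ₁ + LpNorm 8 φ₁)
  set B := C * (1 + h ^ 2) ^ 2 * M ^ (4 * p) with hB
  have hest : ∀ u : Plane → ℝ, MemH1 u → IsHolder (1/4 - δ) u →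
      Integrable (fun x => |u x| ^ (8:ℝ)) → H1locSq 6 u ≤ A ^ 2 →
      Real.sqrt (H1Sq u) ≤ h → holderNorm (1/4 - δ) u + LpNorm 8 u ≤ M →
      Integrable (fun x => fWeight (u x) ^ p) ∧ ∫ x, fWeight (u x) ^ p ≤ B := by
    intro u hu hh h8 hl hhu hMu
    have h1 := supNorm_nonneg u
    have h2 := holderSemi_nonneg (1/4 - δ) u
    have h3 := LpNorm_nonneg 8 u
    unfold holderNorm at hMu
    have hM0 : 0 ≤ M := by linarith
    have hB0 : 0 ≤ B := by positivity
    have hfin := hmain u M h hu hl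
      (by rw [← Real.sq_sqrt (H1Sq_nonneg u)]; exact pow_le_pow_left₀ (Real.sqrt_nonneg _) hhu 2)
      (fun x => (le_ciSup (bddAbove_range_abs hu hα hh) x).trans
        (show supNorm u ≤ M by linarith))
      (fun x y => (abs_sub_le_holderSemi hα hh x y).trans
        (mul_le_mul_of_nonneg_right (by linarith) (by positivity)))
      h8 (by
        rw [integral_rpow_eq_LpNorm_rpow (by norm_num)]
        exact Real.rpow_le_rpow h3 (by linarith) (by norm_num))
    have hnn : ∀ x, 0 ≤ fWeight (u x) ^ p := fun x => Real.rpow_nonneg (fWeight_nonneg _) _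
    have hcont : Continuous fun x => fWeight (u x) ^ p :=
      (continuous_fWeight.comp hu.1.continuous).rpow_const fun _ => Or.inr hp0.le
    constructor
    · refine ⟨hcont.aestronglyMeasurable, ?_⟩
      rw [hasFiniteIntegral_iff_ofReal (Filter.Eventually.of_forall hnn)]
      exact hfin.trans_lt ENNReal.ofReal_lt_top
    · rw [integral_eq_lintegral_of_nonneg_ae (Filter.Eventually.of_forall hnn)
        hcont.aestronglyMeasurable]
      exact ENNReal.toReal_le_of_le_ofReal hB0 hfin
  obtain ⟨hi₀, hb₀⟩ := hest φ₀ hφ₀ hh₀ h8₀ hl₀ (le_max_left _ _) (le_max_left _ _)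
  obtain ⟨hi₁, hb₁⟩ := hest φ₁ hφ₁ hh₁ h8₁ hl₁ (le_max_right _ _) (le_max_right _ _)
  have hM0 : 0 ≤ M := le_max_of_le_left (add_nonneg
    (add_nonneg (supNorm_nonneg _) (holderSemi_nonneg _ _)) (LpNorm_nonneg _ _))
  have hc₀ := hφ₀.1.continuous
  have hc₁ := hφ₁.1.continuous
  have hWc : Continuous fun x => fWeight (φ₀ x) + fWeight (φ₁ x) :=
    (continuous_fWeight.comp hc₀).add (continuous_fWeight.comp hc₁)
  have hW0 : ∀ x, 0 ≤ fWeight (φ₀ x) + fWeight (φ₁ x) := fun x =>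
    add_nonneg (fWeight_nonneg _) (fWeight_nonneg _)
  have hWle : ∀ x, (fWeight (φ₀ x) + fWeight (φ₁ x)) ^ p ≤
      2 ^ p * (fWeight (φ₀ x) ^ p + fWeight (φ₁ x) ^ p) := fun x =>
    add_rpow_le_two_rpow_mul (fWeight_nonneg _) (fWeight_nonneg _) hp0.le
  have hsum := (hi₀.add hi₁).const_mul (2 ^ p)
  have hWi : Integrable fun x => (fWeight (φ₀ x) + fWeight (φ₁ x)) ^ p := by
    refine hsum.mono' (hWc.rpow_const fun _ => Or.inr hp0.le).aestronglyMeasurable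
      (Filter.Eventually.of_forall fun x => ?_)
    rw [Real.norm_of_nonneg (Real.rpow_nonneg (hW0 x) _)]
    exact hWle x
  have hWint : ∫ x, (fWeight (φ₀ x) + fWeight (φ₁ x)) ^ p ≤ 2 ^ p * (B + B) := by
    refine (integral_mono hWi hsum hWle).trans ?_
    rw [integral_const_mul]
    simp only [Pi.add_apply]
    rw [integral_add hi₀ hi₁]
    gcongr
  have hDi : Integrable fun x => |φ₁ x - φ₀ x| ^ (2 / δ) := by
    refine ((hδi₁.add hδi₀).const_mul (2 ^ (2 / δ))).mono'
      ((hc₁.sub hc₀).abs.rpow_const fun _ => Or.inr (by positivity)).aestronglyMeasurable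
      (Filter.Eventually.of_forall fun x => ?_)
    rw [Real.norm_of_nonneg (by positivity)]
    exact (Real.rpow_le_rpow (abs_nonneg _) (abs_sub _ _) (by positivity)).trans
      (add_rpow_le_two_rpow_mul (abs_nonneg _) (abs_nonneg _) (by positivity))
  refine (LpNorm_two_le hδ0 (by linarith) (hc₁.sub hc₀) hWc hW0
    (fun x => abs_f_sub_le (φ₀ x) (φ₁ x)) hDi hWi).trans ?_
  refine mul_le_mul_of_nonneg_right ?_ (LpNorm_nonneg _ _)
  calc _ ≤ (2 ^ p * (B + B)) ^ (1 / p) :=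
        Real.rpow_le_rpow (integral_nonneg fun x => Real.rpow_nonneg (hW0 x) _) hWint (by positivity)
    _ = (2 ^ p * (2 * (C * (1 + h ^ 2) ^ 2)) * M ^ (4 * p)) ^ (1 / p) := by
        rw [hB]; congr 1; ring
    _ = _ := by
        rw [Real.mul_rpow (by positivity) (by positivity), ← Real.rpow_mul hM0]
        congr 1
        rw [mul_assoc, mul_one_div_cancel hp0.ne', mul_one]
        norm_cast
end
end

section
/- Let θ ∈ (0,1), r > 0, and let λ > 1 be such that (√(θλ) + 4√(2(λ−1))/r)² + 2(λ−1) < 1 < λ. Then there exists a constant C, depending only on θ, r, λ, such that every real-valued u ∈ H¹(ℝ²) satisfying ‖∇u‖²_{L²} + ‖u‖²_{L²} ≤ 1 and ‖u‖²_{H¹[r]} ≤ θ obeys ∫_{ℝ²} (e^{4πλ|u(x)|²} − 1) dx ≤ C ‖u‖²_{L²(ℝ²)}. -/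
open MeasureTheory Real Classical
open scoped ENNReal RealInnerProductSpace

noncomputable section

/-- The point of the unit circle at angle `φ`. -/
def circlePoint (φ : ℝ) : Plane := !₂[cos φ, sin φ]

lemma norm_circlePoint (φ : ℝ) : ‖circlePoint φ‖ = 1 := by
  simp [circlePoint, EuclideanSpace.norm_eq]

lemma continuous_circlePoint : Continuous circlePoint := by
  unfold circlePoint
  refine (PiLp.continuous_toLp 2 _).comp (continuous_pi fun i => ?_)
  fin_cases i
  · exact continuous_cos
  · exact continuous_sin

/-- Integration in polar coordinates on the plane. -/
lemma lintegral_polar {g : Plane → ℝ≥0∞} (hg : Measurable g) :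
    ∫⁻ z, g z = ∫⁻ φ in Set.Ioo (-π) π, ∫⁻ ρ in Set.Ioi (0 : ℝ),
      ENNReal.ofReal ρ * g (ρ • circlePoint φ) := by
  have h1 : ∫⁻ z, g z = ∫⁻ p : ℝ × ℝ, g (!₂[p.1, p.2]) := by
    rw [← (PiLp.volume_preserving_toLp (Fin 2)).lintegral_comp hg,
      ← (volume_preserving_finTwoArrow ℝ).symm.lintegral_comp]
    · rfl
    · exact hg.comp (PiLp.volume_preserving_toLp (Fin 2)).measurable
  have hm : Measurable fun p : ℝ × ℝ => ENNReal.ofReal p.1 * g (p.1 • circlePoint p.2) := by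
    refine (ENNReal.measurable_ofReal.comp measurable_fst).mul (hg.comp ?_)
    exact (continuous_fst.smul (continuous_circlePoint.comp continuous_snd)).measurable
  rw [h1, ← lintegral_comp_polarCoord_symm, polarCoord_target]
  have h2 : ∀ p : ℝ × ℝ, ENNReal.ofReal p.1 • g (!₂[(polarCoord.symm p).1, (polarCoord.symm p).2])
      = ENNReal.ofReal p.1 * g (p.1 • circlePoint p.2) := by
    intro p
    rw [smul_eq_mul]
    congr 2
    ext i
    fin_cases i <;> simp [circlePoint, polarCoord_symm_apply]
  simp_rw [h2]
  rw [Measure.volume_eq_prod, ← Measure.prod_restrict, lintegral_prod_symm' _ hm]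

/-- A function on the half-line which vanishes somewhere is controlled by the negative part of
its derivative. -/
lemma ofReal_le_lintegral_neg_deriv {w w' : ℝ → ℝ} (hw : ∀ t, HasDerivAt w (w' t) t) {R : ℝ}
    (hR : 0 < R) (hwR : w R = 0) :
    ENNReal.ofReal (w 0) ≤ ∫⁻ t in Set.Ioi (0 : ℝ), ENNReal.ofReal (-w' t) := by
  have hmeas : Measurable w' := by
    rw [show w' = deriv w from funext fun t => ((hw t).deriv).symm]
    exact measurable_deriv w
  set I := ∫⁻ t in Set.Ioi (0 : ℝ), ENNReal.ofReal (-w' t)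
  by_cases hI : I = ⊤
  · rw [hI]; exact le_top
  set ψ : ℝ → ℝ := fun t => max (-w' t) 0
  have hψm : Measurable ψ := hmeas.neg.max measurable_const
  have hle : ∫⁻ t in Set.Ioc 0 R, ENNReal.ofReal (ψ t) ≤ I := by
    calc _ = ∫⁻ t in Set.Ioc 0 R, ENNReal.ofReal (-w' t) := by
            refine lintegral_congr fun t => ?_
            simp only [ψ]
            rw [ENNReal.ofReal_max, ENNReal.ofReal_zero, max_eq_left zero_le]
      _ ≤ I := lintegral_mono_set Set.Ioc_subset_Ioi_self
  have hint : IntegrableOn ψ (Set.Ioc 0 R) := by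
    refine ⟨hψm.aestronglyMeasurable, ?_⟩
    have hψ0 : 0 ≤ᵐ[volume.restrict (Set.Ioc 0 R)] ψ :=
      Filter.Eventually.of_forall fun t => le_max_right _ _
    rw [hasFiniteIntegral_iff_ofReal hψ0]
    exact lt_of_le_of_lt hle (lt_top_iff_ne_top.2 hI)
  have key := intervalIntegral.sub_le_integral_of_hasDeriv_right_of_le (g := fun t => -w t)
    (g' := fun t => -w' t) (φ := ψ) hR.le
    (fun t _ => (hw t).neg.continuousAt.continuousWithinAt)
    (fun t _ => (hw t).neg.hasDerivWithinAt) ((integrableOn_Icc_iff_integrableOn_Ioc).2 hint)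
    (fun t _ => le_max_left _ _)
  rw [hwR, intervalIntegral.integral_of_le hR.le] at key
  refine (ENNReal.ofReal_le_ofReal (show w 0 ≤ _ by linarith)).trans ?_
  rw [ofReal_integral_eq_lintegral_ofReal hint
    (Filter.Eventually.of_forall fun t => le_max_right _ _)]
  exact hle

/-- A smooth function vanishing outside a set of finite measure is dominated pointwise by the
potential of the inward part of its gradient. -/
lemma two_pi_mul_le_lintegral {v : Plane → ℝ} (hv : Differentiable ℝ v)
    (hfin : volume {z | v z ≠ 0} ≠ ⊤) (x : Plane) :
    ENNReal.ofReal (2 * π) * ENNReal.ofReal (v x) ≤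
      ∫⁻ z, ENNReal.ofReal (-(fderiv ℝ v (x + z) z) / ‖z‖ ^ 2) := by
  have hms : MeasurableSet {z | v z ≠ 0} :=
    (hv.continuous.measurable (measurableSet_singleton 0)).compl
  have hcl : Measurable fun z : Plane => fderiv ℝ v (x + z) z := by
    have h1 : Measurable fun z : Plane => fderiv ℝ v (x + z) :=
      (measurable_fderiv ℝ v).comp (measurable_const_add x)
    exact (isBoundedBilinearMap_apply (𝕜 := ℝ) (E := Plane) (F := ℝ)).continuous.measurable.comp
      (h1.prodMk measurable_id)
  have hm : Measurable fun z : Plane => ENNReal.ofReal (-(fderiv ℝ v (x + z) z) / ‖z‖ ^ 2) :=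
    ENNReal.measurable_ofReal.comp (hcl.neg.div (measurable_norm.pow_const 2))
  rw [lintegral_polar hm]
  set g : Plane → ℝ≥0∞ := fun z => {z | v z ≠ 0}.indicator (fun _ => 1) (x + z)
  have hg : Measurable g := (measurable_const.indicator hms).comp (measurable_const_add x)
  have hgi : ∫⁻ z, g z ≠ ⊤ := by
    rw [lintegral_add_left_eq_self (fun z => {z | v z ≠ 0}.indicator (fun _ => (1 : ℝ≥0∞)) z) x,
      lintegral_indicator_const hms, one_mul]
    exact hfin
  rw [lintegral_polar hg] at hgi
  have hgm : Measurable fun φ : ℝ => ∫⁻ ρ in Set.Ioi (0 : ℝ),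
      ENNReal.ofReal ρ * g (ρ • circlePoint φ) := by
    refine Measurable.lintegral_prod_right' (f := fun p : ℝ × ℝ =>
      ENNReal.ofReal p.2 * g (p.2 • circlePoint p.1)) ?_
    refine (ENNReal.measurable_ofReal.comp measurable_snd).mul (hg.comp ?_)
    exact (continuous_snd.smul (continuous_circlePoint.comp continuous_fst)).measurable
  have hae := ae_lt_top hgm hgi
  have hzero : ∀ᵐ φ ∂(volume.restrict (Set.Ioo (-π) π)),
      ENNReal.ofReal (v x) ≤ ∫⁻ ρ in Set.Ioi (0 : ℝ), ENNReal.ofReal ρ * ENNReal.ofReal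
        (-(fderiv ℝ v (x + ρ • circlePoint φ) (ρ • circlePoint φ)) / ‖ρ • circlePoint φ‖ ^ 2) := by
    filter_upwards [hae] with φ hφ
    have hex : ∃ R : ℝ, 0 < R ∧ v (x + R • circlePoint φ) = 0 := by
      by_contra! hcon
      refine hφ.ne (top_le_iff.1 ?_)
      calc (⊤ : ℝ≥0∞) = ∫⁻ ρ in Set.Ioi (1 : ℝ), 1 := by simp
        _ ≤ ∫⁻ ρ in Set.Ioi (1 : ℝ), ENNReal.ofReal ρ * g (ρ • circlePoint φ) := by
            refine setLIntegral_mono' measurableSet_Ioi fun ρ hρ => ?_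
            have hρ' : (1 : ℝ) < ρ := hρ
            have : g (ρ • circlePoint φ) = 1 := by
              simp only [g]
              exact Set.indicator_of_mem (hcon ρ (by linarith)) _
            rw [this, mul_one, ENNReal.one_le_ofReal]
            exact hρ'.le
        _ ≤ _ := lintegral_mono_set (Set.Ioi_subset_Ioi zero_le_one)
    obtain ⟨R, hR, hvR⟩ := hex
    have hd : ∀ t : ℝ, HasDerivAt (fun t : ℝ => v (x + t • circlePoint φ))
        (fderiv ℝ v (x + t • circlePoint φ) (circlePoint φ)) t := by
      intro t
      have h1 : HasDerivAt (fun t : ℝ => x + t • circlePoint φ) (circlePoint φ) t := by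
        simpa using ((hasDerivAt_id t).smul_const (circlePoint φ)).const_add x
      exact (hv (x + t • circlePoint φ)).hasFDerivAt.comp_hasDerivAt t h1
    have := ofReal_le_lintegral_neg_deriv hd hR hvR
    simp only [zero_smul, add_zero] at this
    refine this.trans (le_of_eq ?_)
    refine setLIntegral_congr_fun measurableSet_Ioi fun ρ hρ => ?_
    have hρ' : (0 : ℝ) < ρ := hρ
    rw [← ENNReal.ofReal_mul hρ'.le]
    congr 1
    rw [norm_smul, norm_circlePoint, map_smul, smul_eq_mul, mul_one, norm_eq_abs, sq_abs]
    field_simp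
  calc ENNReal.ofReal (2 * π) * ENNReal.ofReal (v x)
      = ∫⁻ φ in Set.Ioo (-π) π, ENNReal.ofReal (v x) := by
        rw [setLIntegral_const, Real.volume_Ioo, mul_comm]
        congr 2
        ring
    _ ≤ _ := lintegral_mono_ae hzero

lemma lintegral_mul_sub_mul {q c : ℝ} (hc : 0 < c) (hq : 0 ≤ q) :
    ∫⁻ ρ in Set.Ioi (0 : ℝ), ENNReal.ofReal (q - c * ρ) = ENNReal.ofReal (q ^ 2 / (2 * c)) := by
  have h0 : 0 ≤ q / c := by positivity
  have h1 : ∫⁻ ρ in Set.Ioi (0 : ℝ), ENNReal.ofReal (q - c * ρ) =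
      ∫⁻ ρ in Set.Ioc 0 (q / c), ENNReal.ofReal (q - c * ρ) := by
    rw [← Set.Ioc_union_Ioi_eq_Ioi h0, lintegral_union measurableSet_Ioi
      (Set.Ioc_disjoint_Ioi le_rfl)]
    convert add_zero _
    rw [setLIntegral_congr_fun measurableSet_Ioi (g := fun _ => 0), lintegral_zero]
    intro ρ hρ
    have : q / c < ρ := hρ
    rw [div_lt_iff₀ hc] at this
    exact ENNReal.ofReal_of_nonpos (by linarith)
  have hcont : Continuous fun ρ : ℝ => q - c * ρ := by fun_prop
  rw [h1, ← ofReal_integral_eq_lintegral_ofReal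
    ((hcont.integrableOn_Icc (a := 0) (b := q / c)).mono_set Set.Ioc_subset_Icc_self)]
  · rw [← intervalIntegral.integral_of_le h0, intervalIntegral.integral_sub (by simp)
      (show IntervalIntegrable (fun ρ => c * ρ) volume 0 (q / c) from
        Continuous.intervalIntegrable (by fun_prop) _ _),
      intervalIntegral.integral_const_mul, integral_id, intervalIntegral.integral_const]
    congr 1
    simp only [smul_eq_mul]
    field_simp
    ring
  · refine (ae_restrict_iff' measurableSet_Ioc).2 (Filter.Eventually.of_forall fun ρ hρ => ?_)
    have := hρ.2
    rw [le_div_iff₀ hc] at this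
    simp only [Pi.zero_apply]
    linarith

lemma integral_linear_sq_circle (a b : ℝ) :
    ∫ φ in (-π)..π, (a * cos φ + b * sin φ) ^ 2 = π * (a ^ 2 + b ^ 2) := by
  have h : ∀ φ : ℝ, (a * cos φ + b * sin φ) ^ 2 =
      (a ^ 2 * cos φ ^ 2 + b ^ 2 * sin φ ^ 2) + 2 * a * b * (sin φ * cos φ) := by intro φ; ring
  simp_rw [h]
  rw [intervalIntegral.integral_add, intervalIntegral.integral_add,
    intervalIntegral.integral_const_mul, intervalIntegral.integral_const_mul,
    intervalIntegral.integral_const_mul, integral_cos_sq, integral_sin_sq, integral_sin_mul_cos₁]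
  · simp
    ring
  all_goals exact Continuous.intervalIntegrable (by fun_prop) _ _

lemma sq_add_sq_le_opNorm_sq (p : Plane →L[ℝ] ℝ) (a b : ℝ)
    (hp : ∀ φ, p (circlePoint φ) = a * cos φ + b * sin φ) : a ^ 2 + b ^ 2 ≤ ‖p‖ ^ 2 := by
  obtain ⟨ψ, hψ⟩ : ∃ ψ : ℝ, a = √(a ^ 2 + b ^ 2) * cos ψ ∧ b = √(a ^ 2 + b ^ 2) * sin ψ := by
    refine ⟨Complex.arg ⟨a, b⟩, ?_, ?_⟩
    · have := Complex.norm_mul_cos_arg ⟨a, b⟩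
      rw [Complex.norm_def, Complex.normSq_mk, ← sq, ← sq] at this
      exact this.symm
    · have := Complex.norm_mul_sin_arg ⟨a, b⟩
      rw [Complex.norm_def, Complex.normSq_mk, ← sq, ← sq] at this
      exact this.symm
  set s := √(a ^ 2 + b ^ 2) with hs
  have hs2 : s ^ 2 = a ^ 2 + b ^ 2 := Real.sq_sqrt (by positivity)
  have h1 : p (circlePoint ψ) = s := by
    rw [hp, hψ.1, hψ.2]
    linear_combination s * sin_sq_add_cos_sq ψ
  have h2 := p.le_opNorm (circlePoint ψ)
  rw [h1, norm_circlePoint, mul_one, norm_eq_abs] at h2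
  rw [← hs2, ← sq_abs s]
  gcongr

/-- Mass of the dipole potential above a positive level. -/
lemma lintegral_dipole_sub_le (p : Plane →L[ℝ] ℝ) {c : ℝ} (hc : 0 < c) :
    ∫⁻ z, ENNReal.ofReal (p z / ‖z‖ ^ 2 - c) ≤ ENNReal.ofReal (π * ‖p‖ ^ 2 / (4 * c)) := by
  set a := p (!₂[1, 0])
  set b := p (!₂[0, 1])
  have hp : ∀ φ, p (circlePoint φ) = a * cos φ + b * sin φ := by
    intro φ
    have : circlePoint φ = cos φ • (!₂[1, 0] : Plane) + sin φ • (!₂[0, 1] : Plane) := by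
      ext i; fin_cases i <;> simp [circlePoint]
    rw [this, map_add, map_smul, map_smul, smul_eq_mul, smul_eq_mul]
    ring
  have hpm : Measurable fun z : Plane => p z / ‖z‖ ^ 2 :=
    p.continuous.measurable.div (measurable_norm.pow_const 2)
  have hm : Measurable fun z : Plane => ENNReal.ofReal (p z / ‖z‖ ^ 2 - c) :=
    ENNReal.measurable_ofReal.comp (hpm.sub_const c)
  have hm' : Measurable fun z : Plane => ENNReal.ofReal (|p z / ‖z‖ ^ 2| - c) :=
    ENNReal.measurable_ofReal.comp ((continuous_abs.measurable.comp hpm).sub_const c)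
  have hsum : 2 * ∫⁻ z, ENNReal.ofReal (p z / ‖z‖ ^ 2 - c) =
      ∫⁻ z, ENNReal.ofReal (|p z / ‖z‖ ^ 2| - c) := by
    have hneg : ∫⁻ z, ENNReal.ofReal (p z / ‖z‖ ^ 2 - c) =
        ∫⁻ z, ENNReal.ofReal (-(p z / ‖z‖ ^ 2) - c) := by
      rw [← (Measure.measurePreserving_neg (volume : Measure Plane)).lintegral_comp hm]
      simp only [map_neg, norm_neg, neg_div]
    rw [two_mul]
    nth_rewrite 2 [hneg]
    rw [← lintegral_add_left hm]
    refine lintegral_congr fun z => ?_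
    rcases le_total 0 (p z / ‖z‖ ^ 2) with h | h
    · rw [abs_of_nonneg h, ENNReal.ofReal_of_nonpos (p := -(p z / ‖z‖ ^ 2) - c) (by linarith),
        add_zero]
    · rw [abs_of_nonpos h, ENNReal.ofReal_of_nonpos (p := p z / ‖z‖ ^ 2 - c) (by linarith),
        zero_add]
  have hcont : Continuous fun φ : ℝ => (a * cos φ + b * sin φ) ^ 2 / (2 * c) := by fun_prop
  have hval : ∫⁻ z, ENNReal.ofReal (|p z / ‖z‖ ^ 2| - c) =
      ENNReal.ofReal (π * (a ^ 2 + b ^ 2) / (2 * c)) := by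
    rw [lintegral_polar hm']
    have hin : ∀ φ : ℝ, (∫⁻ ρ in Set.Ioi (0 : ℝ), ENNReal.ofReal ρ * ENNReal.ofReal
        (|p (ρ • circlePoint φ) / ‖ρ • circlePoint φ‖ ^ 2| - c)) =
        ENNReal.ofReal ((a * cos φ + b * sin φ) ^ 2 / (2 * c)) := by
      intro φ
      rw [← sq_abs, ← lintegral_mul_sub_mul hc (abs_nonneg _)]
      refine setLIntegral_congr_fun measurableSet_Ioi fun ρ hρ => ?_
      have hρ' : (0 : ℝ) < ρ := hρ
      rw [← ENNReal.ofReal_mul hρ'.le, norm_smul, norm_circlePoint, map_smul, smul_eq_mul, mul_one,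
        norm_eq_abs, sq_abs, hp, abs_div, abs_mul, abs_of_pos hρ', abs_of_pos (pow_pos hρ' 2)]
      congr 1
      field_simp
    simp_rw [hin]
    rw [setLIntegral_congr Ioo_ae_eq_Ioc, ← ofReal_integral_eq_lintegral_ofReal
      ((hcont.integrableOn_Icc (a := -π) (b := π)).mono_set Set.Ioc_subset_Icc_self)
      (Filter.Eventually.of_forall fun φ => by positivity),
      ← intervalIntegral.integral_of_le (by linarith [pi_pos]), intervalIntegral.integral_div,
      integral_linear_sq_circle]
  rw [hval] at hsum
  have hle : 2 * ∫⁻ z, ENNReal.ofReal (p z / ‖z‖ ^ 2 - c) ≤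
      2 * ENNReal.ofReal (π * ‖p‖ ^ 2 / (4 * c)) := by
    rw [hsum, two_mul (ENNReal.ofReal _), ← ENNReal.ofReal_add (by positivity) (by positivity)]
    refine ENNReal.ofReal_le_ofReal ?_
    have := sq_add_sq_le_opNorm_sq p a b hp
    rw [show π * ‖p‖ ^ 2 / (4 * c) + π * ‖p‖ ^ 2 / (4 * c) = π * ‖p‖ ^ 2 / (2 * c) by
      ring]
    gcongr
  exact (ENNReal.mul_le_mul_iff_right two_ne_zero ENNReal.ofNat_ne_top).1 hle

/-- Among sets of given area, disks maximise the dipole field at a boundary point. -/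
lemma setLIntegral_dipole_le (p : Plane →L[ℝ] ℝ) {A : Set Plane}
    (hfin : volume A ≠ ⊤) (y : Plane) :
    ∫⁻ x in A, ENNReal.ofReal (p (x - y) / ‖x - y‖ ^ 2) ≤
      ENNReal.ofReal (√(π * volume.real A) * ‖p‖) := by
  rcases eq_or_ne (volume A) 0 with h0 | h0
  · rw [Measure.restrict_eq_zero.2 h0, lintegral_zero_measure]
    exact zero_le
  rcases (norm_nonneg p).eq_or_lt with hp0 | hp0
  · have : p = 0 := norm_eq_zero.1 hp0.symm
    simp [this]
  set m := volume.real A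
  have hmpos : 0 < m := ENNReal.toReal_pos h0 hfin
  set s := √(π * m)
  have hs : 0 < s := Real.sqrt_pos.2 (by positivity)
  have hs2 : s ^ 2 = π * m := Real.sq_sqrt (by positivity)
  set c : ℝ := π * ‖p‖ / (2 * s) with hc_def
  have hc : 0 < c := by positivity
  have hpm : Measurable fun z : Plane => ENNReal.ofReal (p z / ‖z‖ ^ 2 - c) :=
    ENNReal.measurable_ofReal.comp
      ((p.continuous.measurable.div (measurable_norm.pow_const 2)).sub_const c)
  calc ∫⁻ x in A, ENNReal.ofReal (p (x - y) / ‖x - y‖ ^ 2)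
      ≤ ∫⁻ x in A, (ENNReal.ofReal c + ENNReal.ofReal (p (x - y) / ‖x - y‖ ^ 2 - c)) := by
        refine lintegral_mono fun x => ?_
        refine le_trans (ENNReal.ofReal_le_ofReal ?_) ENNReal.ofReal_add_le
        linarith
    _ = ENNReal.ofReal c * volume A + ∫⁻ x in A, ENNReal.ofReal (p (x - y) / ‖x - y‖ ^ 2 - c) := by
        rw [lintegral_add_left measurable_const, setLIntegral_const]
    _ ≤ ENNReal.ofReal c * volume A + ∫⁻ x, ENNReal.ofReal (p (x - y) / ‖x - y‖ ^ 2 - c) := by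
        gcongr
        exact Measure.restrict_le_self
    _ = ENNReal.ofReal (c * m) + ∫⁻ z, ENNReal.ofReal (p z / ‖z‖ ^ 2 - c) := by
        rw [lintegral_sub_right_eq_self (fun z => ENNReal.ofReal (p z / ‖z‖ ^ 2 - c)) y,
          ENNReal.ofReal_mul hc.le, ofReal_measureReal hfin]
    _ ≤ ENNReal.ofReal (c * m) + ENNReal.ofReal (π * ‖p‖ ^ 2 / (4 * c)) := by
        gcongr
        exact lintegral_dipole_sub_le p hc
    _ = ENNReal.ofReal (s * ‖p‖) := by
        rw [← ENNReal.ofReal_add (by positivity) (by positivity)]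
        congr 1
        rw [hc_def]
        field_simp
        linear_combination (-4 : ℝ) * hs2

/-- The sharp planar isoperimetric inequality in functional form. -/
lemma lintegral_le_sqrt_mul_lintegral_fderiv {v : Plane → ℝ} (hv : Differentiable ℝ v)
    (hfin : volume {z | v z ≠ 0} ≠ ⊤) {A : Set Plane}
    (hAfin : volume A ≠ ⊤) :
    ENNReal.ofReal (2 * π) * ∫⁻ x in A, ENNReal.ofReal (v x) ≤
      ENNReal.ofReal √(π * volume.real A) * ∫⁻ y, ENNReal.ofReal ‖fderiv ℝ v y‖ := by
  have hm : Measurable fun q : Plane × Plane =>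
      ENNReal.ofReal (-(fderiv ℝ v q.2 (q.2 - q.1)) / ‖q.2 - q.1‖ ^ 2) := by
    have h1 : Measurable fun q : Plane × Plane => fderiv ℝ v q.2 :=
      (measurable_fderiv ℝ v).comp measurable_snd
    have h2 : Measurable fun q : Plane × Plane => q.2 - q.1 := measurable_snd.sub measurable_fst
    have h3 : Measurable fun q : Plane × Plane => fderiv ℝ v q.2 (q.2 - q.1) :=
      (isBoundedBilinearMap_apply (𝕜 := ℝ) (E := Plane) (F := ℝ)).continuous.measurable.comp
        (h1.prodMk h2)
    exact ENNReal.measurable_ofReal.comp (h3.neg.div (h2.norm.pow_const 2))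
  calc ENNReal.ofReal (2 * π) * ∫⁻ x in A, ENNReal.ofReal (v x)
      = ∫⁻ x in A, ENNReal.ofReal (2 * π) * ENNReal.ofReal (v x) := by
        rw [lintegral_const_mul]
        exact ENNReal.measurable_ofReal.comp hv.continuous.measurable
    _ ≤ ∫⁻ x in A, ∫⁻ z, ENNReal.ofReal (-(fderiv ℝ v (x + z) z) / ‖z‖ ^ 2) :=
        lintegral_mono fun x => two_pi_mul_le_lintegral hv hfin x
    _ = ∫⁻ x in A, ∫⁻ y, ENNReal.ofReal (-(fderiv ℝ v y (y - x)) / ‖y - x‖ ^ 2) := by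
        refine lintegral_congr fun x => ?_
        simpa using lintegral_add_left_eq_self (μ := volume)
          (fun y => ENNReal.ofReal (-(fderiv ℝ v y (y - x)) / ‖y - x‖ ^ 2)) x
    _ = ∫⁻ y, ∫⁻ x in A, ENNReal.ofReal (-(fderiv ℝ v y (y - x)) / ‖y - x‖ ^ 2) :=
        lintegral_lintegral_swap hm.aemeasurable
    _ = ∫⁻ y, ∫⁻ x in A, ENNReal.ofReal ((fderiv ℝ v y) (x - y) / ‖x - y‖ ^ 2) := by
        refine lintegral_congr fun y => lintegral_congr fun x => ?_
        rw [← map_neg, neg_sub, norm_sub_rev]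
    _ ≤ ∫⁻ y, ENNReal.ofReal (√(π * volume.real A) * ‖fderiv ℝ v y‖) :=
        lintegral_mono fun y => setLIntegral_dipole_le _ hAfin y
    _ = _ := by
        simp_rw [ENNReal.ofReal_mul (Real.sqrt_nonneg _)]
        rw [lintegral_const_mul]
        exact ENNReal.measurable_ofReal.comp (measurable_fderiv ℝ v).norm

/-- A continuously differentiable truncation with slope at most one. -/
lemma exists_truncation {a b t : ℝ} (hab : a < b) (ht : t < b - a) :
    ∃ φ φ' : ℝ → ℝ, (∀ s, HasDerivAt φ (φ' s) s) ∧ (∀ s, 0 ≤ φ' s) ∧ (∀ s, φ' s ≤ 1) ∧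
      (∀ s, s ∉ Set.Ioo a b → φ' s = 0) ∧ (∀ s ≤ a, φ s = 0) ∧ (∀ s, b ≤ s → φ s = φ b) ∧
      t ≤ φ b ∧ φ b ≤ b - a := by
  have hba : 0 < b - a := sub_pos.2 hab
  obtain ⟨m, hm⟩ : ∃ m : ℕ, (b - a) / (b - a - t) < m := exists_nat_gt _
  set l : ℝ → ℝ := fun s => (2 * s - a - b) / (b - a) with hl
  set g : ℝ → ℝ := fun s => max 0 (1 - l s ^ (2 * m)) with hg
  have hlc : Continuous l := by fun_prop
  have hgc : Continuous g := continuous_const.max (continuous_const.sub (hlc.pow _))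
  have hg0 : ∀ s, 0 ≤ g s := fun s => le_max_left _ _
  have hg1 : ∀ s, g s ≤ 1 := fun s => by
    refine max_le zero_le_one ?_
    have : 0 ≤ l s ^ (2 * m) := (even_two_mul m).pow_nonneg _
    linarith
  have hgz : ∀ s, s ∉ Set.Ioo a b → g s = 0 := by
    intro s hs
    refine max_eq_left ?_
    have h1 : 1 ≤ |l s| := by
      rw [hl]
      simp only
      rw [abs_div, abs_of_pos hba, le_div_iff₀ hba, one_mul, le_abs]
      rw [Set.mem_Ioo, not_and_or, not_lt, not_lt] at hs
      rcases hs with h | h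
      · right; linarith
      · left; linarith
    have h2 : 1 ≤ l s ^ (2 * m) := by
      rw [← (even_two_mul m).pow_abs]
      exact one_le_pow₀ h1
    linarith
  have hgi : ∀ x y, IntervalIntegrable g volume x y := fun x y => hgc.intervalIntegrable x y
  have hval : ∫ s in a..b, g s = (b - a) - (b - a) / (2 * m + 1) := by
    have h1 : ∫ s in a..b, g s = ∫ s in a..b, (1 - l s ^ (2 * m)) := by
      refine intervalIntegral.integral_congr fun s hs => ?_
      rw [Set.uIcc_of_le hab.le] at hs
      refine max_eq_right (sub_nonneg.2 ?_)
      rw [← (even_two_mul m).pow_abs]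
      refine pow_le_one₀ (abs_nonneg _) ?_
      rw [hl]
      simp only
      rw [abs_div, abs_of_pos hba, div_le_one hba, abs_le]
      constructor <;> linarith [hs.1, hs.2]
    have hd : ∀ s ∈ Set.uIcc a b, HasDerivAt
        (fun s => s - (b - a) / (2 * (2 * m + 1)) * l s ^ (2 * m + 1)) (1 - l s ^ (2 * m)) s := by
      intro s _
      have hl1 : HasDerivAt l (2 / (b - a)) s := by
        have := ((((hasDerivAt_id s).const_mul 2).sub_const a).sub_const b).div_const (b - a)
        simpa using this
      refine ((hasDerivAt_id s).sub
        ((hl1.pow (2 * m + 1)).const_mul ((b - a) / (2 * (2 * m + 1))))).congr_deriv ?_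
      rw [Nat.add_sub_cancel]
      push_cast
      field_simp
    rw [h1, intervalIntegral.integral_eq_sub_of_hasDerivAt hd
      ((continuous_const.sub (hlc.pow _)).intervalIntegrable _ _)]
    have hlb : l b = 1 := by
      rw [hl]; simp only; rw [div_eq_one_iff_eq hba.ne']; ring
    have hla : l a = -1 := by
      rw [hl]; simp only; rw [div_eq_iff hba.ne']; ring
    rw [hlb, hla, one_pow, Odd.neg_one_pow ⟨m, rfl⟩]
    field_simp
    ring
  refine ⟨fun s => ∫ τ in a..s, g τ, g, fun s => ?_, hg0, hg1, hgz, fun s hs => ?_, fun s hs => ?_,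
    ?_, ?_⟩
  · exact intervalIntegral.integral_hasDerivAt_right (hgi _ _)
      (hgc.stronglyMeasurableAtFilter _ _) hgc.continuousAt
  · refine (intervalIntegral.integral_congr (g := fun _ => 0) fun τ hτ => ?_).trans (by simp)
    rw [Set.uIcc_of_ge hs] at hτ
    exact hgz τ fun h => by linarith [h.1, hτ.2]
  · simp only
    rw [← intervalIntegral.integral_add_adjacent_intervals (hgi a b) (hgi b s),
      add_eq_left]
    refine (intervalIntegral.integral_congr (g := fun _ => 0) fun τ hτ => ?_).trans (by simp)
    rw [Set.uIcc_of_le hs] at hτ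
    exact hgz τ fun h => by linarith [h.2, hτ.1]
  · simp only
    rw [hval]
    have h1 : 0 < b - a - t := by linarith
    rw [div_lt_iff₀ h1] at hm
    have h2 : (b - a) / (2 * m + 1) ≤ b - a - t := by
      rw [div_le_iff₀ (by positivity)]
      nlinarith [(Nat.cast_nonneg m : (0 : ℝ) ≤ m)]
    linarith
  · simp only
    rw [hval]
    have : 0 ≤ (b - a) / (2 * m + 1) := by positivity
    linarith

lemma sq_setIntegral_le_measureReal_mul {α : Type*} [MeasurableSpace α] {μ : Measure α}
    {g : α → ℝ} {S : Set α} (hS : μ S ≠ ⊤) (hg : AEStronglyMeasurable g μ)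
    (hg2 : IntegrableOn (fun x => g x ^ 2) S μ) :
    IntegrableOn g S μ ∧ (∫ x in S, g x ∂μ) ^ 2 ≤ μ.real S * ∫ x in S, g x ^ 2 ∂μ := by
  have : IsFiniteMeasure (μ.restrict S) := ⟨by simpa using hS.lt_top⟩
  have hL : MemLp g 2 (μ.restrict S) := (memLp_two_iff_integrable_sq hg.restrict).2 hg2
  have hi : IntegrableOn g S μ := hL.integrable one_le_two
  refine ⟨hi, ?_⟩
  have hquad : ∀ t : ℝ, 0 ≤ μ.real S * (t * t) + (-2 * ∫ x in S, g x ∂μ) * t +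
      ∫ x in S, g x ^ 2 ∂μ := by
    intro t
    have h0 : 0 ≤ ∫ x in S, (g x - t) ^ 2 ∂μ := integral_nonneg fun x => sq_nonneg _
    have h1 : ∀ x, (g x - t) ^ 2 = g x ^ 2 + (-2 * t) * g x + t ^ 2 := fun x => by ring
    simp_rw [h1] at h0
    have hsum : Integrable (fun x => g x ^ 2 + (-2 * t) * g x) (μ.restrict S) :=
      hg2.add (hi.const_mul _)
    rw [integral_add hsum (integrable_const _),
      integral_add hg2 (hi.const_mul _), integral_const_mul, setIntegral_const, smul_eq_mul] at h0
    linarith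
  have := discrim_le_zero hquad
  rw [discrim] at this
  linarith

/-- Capacity estimate between two superlevel sets. -/
lemma capacity_superlevel_le {u : Plane → ℝ} (hu : Differentiable ℝ u)
    (hG : Integrable fun x => gradNorm u x ^ 2) {a b : ℝ} (hab : a < b)
    (hfin : volume {x | a < u x} ≠ ⊤) :
    4 * π * (b - a) ^ 2 * volume.real {x | b < u x} ≤
      ((∫ x in {x | a < u x}, gradNorm u x ^ 2) - ∫ x in {x | b < u x}, gradNorm u x ^ 2) *
        (volume.real {x | a < u x} - volume.real {x | b < u x}) := by
  have hum : Measurable u := hu.continuous.measurable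
  have hma : MeasurableSet {x | a < u x} := measurableSet_lt measurable_const hum
  have hmb : MeasurableSet {x | b < u x} := measurableSet_lt measurable_const hum
  have hsub : {x | b < u x} ⊆ {x | a < u x} := fun x hx => hab.trans hx
  have hfinb : volume {x | b < u x} ≠ ⊤ := measure_ne_top_of_subset hsub hfin
  set S := {x | a < u x} \ {x | b < u x} with hSdef
  have hSm : MeasurableSet S := hma.diff hmb
  have hSfin : volume S ≠ ⊤ := measure_ne_top_of_subset Set.sdiff_subset hfin
  rw [← setIntegral_sdiff hmb hG.integrableOn hsub, ← measureReal_sdiff hsub hmb hfin, ← hSdef]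
  have hgm : Measurable (gradNorm u) := (measurable_fderiv ℝ u).norm
  obtain ⟨hXi, hX⟩ := sq_setIntegral_le_measureReal_mul hSfin hgm.aestronglyMeasurable
    hG.integrableOn
  set X := ∫ x in S, gradNorm u x
  set m := volume.real {x | b < u x}
  have hm0 : 0 ≤ m := measureReal_nonneg
  have hX0 : 0 ≤ X := integral_nonneg fun x => norm_nonneg _
  rcases hm0.eq_or_lt with hmz | hmpos
  · rw [← hmz, mul_zero]
    exact mul_nonneg (integral_nonneg fun x => sq_nonneg _) measureReal_nonneg
  have main : ∀ t : ℝ, 0 ≤ t → t < b - a → 4 * π * t ^ 2 * m ≤ X ^ 2 := by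
    intro t ht0 htlt
    obtain ⟨φ, φ', hd, h0, h1, hz, hφa, hφb, htb, -⟩ := exists_truncation hab htlt
    have hv : ∀ x, HasFDerivAt (fun x => φ (u x)) (φ' (u x) • fderiv ℝ u x) x := fun x =>
      (hd (u x)).comp_hasFDerivAt x (hu x).hasFDerivAt
    have hvfin : volume {z | φ (u z) ≠ 0} ≠ ⊤ := by
      refine measure_ne_top_of_subset (fun z hz => ?_) hfin
      by_contra hcon
      exact hz (hφa _ (not_lt.1 hcon))
    have key := lintegral_le_sqrt_mul_lintegral_fderiv (fun x => (hv x).differentiableAt) hvfin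
      hfinb
    have hl : ENNReal.ofReal (t * m) ≤ ∫⁻ x in {x | b < u x}, ENNReal.ofReal (φ (u x)) := by
      rw [ENNReal.ofReal_mul ht0, ofReal_measureReal hfinb, ← setLIntegral_const]
      refine setLIntegral_mono' hmb fun x hx => ENNReal.ofReal_le_ofReal ?_
      rw [hφb _ (le_of_lt hx)]
      exact htb
    have hr : ∫⁻ y, ENNReal.ofReal ‖fderiv ℝ (fun x => φ (u x)) y‖ ≤ ENNReal.ofReal X := by
      rw [ofReal_integral_eq_lintegral_ofReal hXi
        (Filter.Eventually.of_forall fun x => norm_nonneg _), ← lintegral_indicator hSm]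
      refine lintegral_mono fun y => ?_
      rw [(hv y).fderiv, norm_smul, norm_eq_abs, abs_of_nonneg (h0 _)]
      by_cases hy : y ∈ S
      · rw [Set.indicator_of_mem hy]
        exact ENNReal.ofReal_le_ofReal (mul_le_of_le_one_left (norm_nonneg _) (h1 _))
      · have : u y ∉ Set.Ioo a b := fun h => hy ⟨h.1, not_lt.2 h.2.le⟩
        rw [hz _ this, zero_mul, ENNReal.ofReal_zero]
        exact zero_le
    have hfinal : ENNReal.ofReal (2 * π * (t * m)) ≤ ENNReal.ofReal (√(π * m) * X) := by
      rw [ENNReal.ofReal_mul (by positivity), ENNReal.ofReal_mul (Real.sqrt_nonneg _)]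
      exact (mul_le_mul_right hl _).trans (key.trans (mul_le_mul_right hr _))
    rw [ENNReal.ofReal_le_ofReal_iff (by positivity)] at hfinal
    have hsq := pow_le_pow_left₀ (by positivity) hfinal 2
    rw [mul_pow (√(π * m)), Real.sq_sqrt (by positivity)] at hsq
    have hpm : 0 < π * m := by positivity
    refine le_of_mul_le_mul_left ?_ hpm
    linarith
  have hlim : Filter.Tendsto (fun t : ℝ => 4 * π * t ^ 2 * m) (nhdsWithin (b - a) (Set.Iio (b - a)))
      (nhds (4 * π * (b - a) ^ 2 * m)) := by
    refine Filter.Tendsto.mono_left (Continuous.tendsto ?_ _) nhdsWithin_le_nhds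
    fun_prop
  have hle : 4 * π * (b - a) ^ 2 * m ≤ X ^ 2 := by
    refine le_of_tendsto hlim ?_
    filter_upwards [Ioo_mem_nhdsLT (sub_pos.2 hab)] with t ht
    exact main t ht.1.le ht.2
  linarith

lemma le_mul_exp_of_step {c κ : ℝ} (hc : 0 < c) (m N : ℕ → ℝ) (hm : ∀ k, 0 ≤ m k)
    (hN : ∀ k, N (k + 1) ≤ N k) (hN0 : ∀ k, 0 ≤ N k) (hNκ : N 0 ≤ κ)
    (hstep : ∀ k, c * m (k + 1) ≤ (N k - N (k + 1)) * (m k - m (k + 1))) {n : ℕ} (hn : 0 < n) :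
    m n ≤ m 0 * exp (-(c * n ^ 2 / (n * c + κ))) := by
  have hκ : 0 ≤ κ := (hN0 0).trans hNκ
  have hpos : ∀ k, 0 < c + (N k - N (k + 1)) := fun k => by linarith [hN k]
  have h1 : ∀ j, m j ≤ m 0 * exp (-∑ k ∈ Finset.range j, c / (c + (N k - N (k + 1)))) := by
    intro j
    induction j with
    | zero => simp
    | succ j ih =>
      have hj : m (j + 1) ≤ m j * exp (-(c / (c + (N j - N (j + 1))))) := by
        refine le_trans ?_ (mul_le_mul_of_nonneg_left (one_sub_le_exp_neg _) (hm j))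
        have h2 : m j * (1 - c / (c + (N j - N (j + 1)))) =
            m j * (N j - N (j + 1)) / (c + (N j - N (j + 1))) := by
          have := (hpos j).ne'
          field_simp
          ring
        rw [h2, le_div_iff₀ (hpos j)]
        linarith [hstep j]
      refine hj.trans ?_
      rw [Finset.sum_range_succ, neg_add, exp_add, ← mul_assoc]
      exact mul_le_mul_of_nonneg_right ih (exp_pos _).le
  refine (h1 n).trans (mul_le_mul_of_nonneg_left (exp_le_exp.2 (neg_le_neg ?_)) (hm 0))
  have hcs := Finset.sq_sum_div_le_sum_sq_div (Finset.range n) (fun _ => (1 : ℝ))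
    (g := fun k => c + (N k - N (k + 1))) (fun k _ => hpos k)
  simp only [Finset.sum_const, Finset.card_range, nsmul_eq_mul, mul_one, one_pow] at hcs
  rw [Finset.sum_add_distrib, Finset.sum_range_sub', Finset.sum_const, Finset.card_range,
    nsmul_eq_mul] at hcs
  have hn' : (0 : ℝ) < n := Nat.cast_pos.2 hn
  calc c * n ^ 2 / (n * c + κ) = c * (n ^ 2 / (n * c + κ)) := by ring
    _ ≤ c * (n ^ 2 / (n * c + (N 0 - N n))) := by
        have h3 : 0 < n * c + (N 0 - N n) := by
          have hanti : N n ≤ N 0 := antitone_nat_of_succ_le hN (Nat.zero_le n)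
          have : 0 < n * c := by positivity
          linarith
        have := hN0 n
        gcongr
        linarith
    _ ≤ c * ∑ k ∈ Finset.range n, 1 / (c + (N k - N (k + 1))) := by gcongr
    _ = _ := by
        rw [Finset.mul_sum]
        simp only [mul_one_div]

/-- Gaussian decay of the distribution function. -/
lemma measureReal_superlevel_le {u : Plane → ℝ} (hu : Differentiable ℝ u)
    (hG : Integrable fun x => gradNorm u x ^ 2) {κ η s t : ℝ}
    (hκ : ∫ x, gradNorm u x ^ 2 ≤ κ) (hη : 0 < η) (ht : 0 < t)
    (hfin : volume {x | s < u x} ≠ ⊤) :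
    volume.real {x | s + t < u x} ≤
      volume.real {x | s < u x} * exp (-(4 * π * t ^ 2 / (κ + η))) := by
  obtain ⟨n, hn⟩ := exists_nat_gt (4 * π * t ^ 2 / η)
  have hκ0 : 0 ≤ κ := (integral_nonneg fun x => sq_nonneg _).trans hκ
  have hn0 : (0 : ℝ) < n := lt_of_le_of_lt (by positivity) hn
  have hh : 0 < t / n := by positivity
  have hsub : ∀ {a b : ℝ}, a ≤ b → {x | b < u x} ⊆ {x | a < u x} :=
    fun hab x hx => lt_of_le_of_lt hab hx
  have key := le_mul_exp_of_step (c := 4 * π * (t / n) ^ 2) (κ := κ) (by positivity)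
    (fun k => volume.real {x | s + k * (t / n) < u x})
    (fun k => ∫ x in {x | s + k * (t / n) < u x}, gradNorm u x ^ 2)
    (fun k => measureReal_nonneg) (fun k => ?_) (fun k => integral_nonneg fun x => sq_nonneg _)
    ((setIntegral_le_integral hG (Filter.Eventually.of_forall fun x => sq_nonneg _)).trans hκ)
    (fun k => ?_) (Nat.cast_pos.1 hn0)
  · rw [mul_div_cancel₀ _ hn0.ne'] at key
    simp only [Nat.cast_zero, zero_mul, add_zero] at key
    refine key.trans (mul_le_mul_of_nonneg_left (exp_le_exp.2 (neg_le_neg ?_)) measureReal_nonneg)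
    rw [div_lt_iff₀ hη] at hn
    have h1 : 4 * π * (t / n) ^ 2 * n ^ 2 = 4 * π * t ^ 2 := by field_simp
    have h2 : n * (4 * π * (t / n) ^ 2) ≤ η := by
      rw [show n * (4 * π * (t / n) ^ 2) = 4 * π * t ^ 2 / n by field_simp, div_le_iff₀ hn0]
      linarith
    rw [h1]
    have : 0 < n * (4 * π * (t / n) ^ 2) := by positivity
    gcongr ?_ / ?_
    all_goals linarith
  · refine setIntegral_mono_set hG.integrableOn
      (Filter.Eventually.of_forall fun x => sq_nonneg _) (hsub ?_).eventuallyLE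
    push_cast
    nlinarith
  · have := capacity_superlevel_le hu hG (a := s + k * (t / n)) (b := s + (k + 1 : ℕ) * (t / n))
      (by push_cast; nlinarith)
      (measure_ne_top_of_subset (hsub (le_add_of_nonneg_right (by positivity))) hfin)
    convert this using 3
    push_cast
    ring

lemma summable_exp_shifted_sq_sub {β : ℝ} (hβ : 1 < β) :
    Summable fun j : ℕ => exp (4 * π * (((j : ℝ) + 2) ^ 2 - β * j ^ 2)) := by
  have hb : 0 < β - 1 := by linarith
  set D : ℝ := 4 + 25 / (4 * (β - 1)) with hD
  have hr : exp (-(4 * π)) < 1 := Real.exp_lt_one_iff.2 (by linarith [pi_pos])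
  refine Summable.of_nonneg_of_le (fun j => (exp_pos _).le) (fun j => ?_)
    ((summable_geometric_of_lt_one (exp_pos _).le hr).mul_left (exp (4 * π * D)))
  rw [← exp_nat_mul, ← exp_add, exp_le_exp]
  have h1 : ((j : ℝ) + 2) ^ 2 - β * j ^ 2 ≤ D - j := by
    have h2 : D - j - (((j : ℝ) + 2) ^ 2 - β * j ^ 2) = (β - 1) * (j - 5 / (2 * (β - 1))) ^ 2 := by
      rw [hD]
      field_simp
      ring
    have h3 : 0 ≤ (β - 1) * ((j : ℝ) - 5 / (2 * (β - 1))) ^ 2 := by positivity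
    linarith
  nlinarith [pi_pos]

lemma exists_const_lintegral_superlevel {κ : ℝ} (hκ1 : κ < 1) :
    ∃ C : ℝ, 0 ≤ C ∧ ∀ u : Plane → ℝ, MemH1 u → ∫ x, gradNorm u x ^ 2 ≤ κ →
      ∫⁻ x in {x | 1 < u x}, ENNReal.ofReal (exp (4 * π * u x ^ 2) - 1) ≤
        ENNReal.ofReal (C * ∫ x, u x ^ 2) := by
  obtain ⟨κ', hκ', hκ'1⟩ : ∃ κ', max κ 0 < κ' ∧ κ' < 1 := exists_between (max_lt hκ1 one_pos)
  have hκ'0 : 0 < κ' := (le_max_right _ _).trans_lt hκ'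
  have hκκ' : κ < κ' := (le_max_left _ _).trans_lt hκ'
  have hsum := summable_exp_shifted_sq_sub (one_lt_inv_iff₀.2 ⟨hκ'0, hκ'1⟩)
  set a : ℕ → ℝ := fun j => exp (4 * π * (((j : ℝ) + 2) ^ 2 - κ'⁻¹ * j ^ 2)) with ha
  have ha0 : ∀ j, 0 ≤ a j := fun j => (exp_pos _).le
  refine ⟨∑' j, a j, tsum_nonneg ha0, fun u hu hκ => ?_⟩
  obtain ⟨hud, hu2, hG⟩ := hu
  have hsub : {x | 1 < u x} ⊆ {x | 1 ≤ u x ^ 2} := fun x (hx : 1 < u x) =>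
    one_le_pow₀ (n := 2) hx.le
  have hfin : volume {x | 1 < u x} ≠ ⊤ :=
    measure_ne_top_of_subset hsub (hu2.measure_ge_lt_top one_pos).ne
  set m := volume.real {x | 1 < u x} with hm
  have hcheb : m ≤ ∫ x, u x ^ 2 := by
    refine (measureReal_mono hsub (hu2.measure_ge_lt_top one_pos).ne).trans ?_
    have := mul_meas_ge_le_integral_of_nonneg
      (Filter.Eventually.of_forall fun x => sq_nonneg (u x)) hu2 1
    rwa [one_mul] at this
  have hdecay : ∀ j : ℕ, volume.real {x | 1 + (j : ℝ) < u x} ≤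
      m * exp (-(4 * π * (j : ℝ) ^ 2 / κ')) := by
    intro j
    rcases Nat.eq_zero_or_pos j with rfl | hj
    · simp [hm]
    · have := measureReal_superlevel_le hud hG hκ (sub_pos.2 hκκ') (Nat.cast_pos.2 hj) hfin
      rwa [add_sub_cancel] at this
  have hcover : {x | 1 < u x} ⊆ ⋃ j : ℕ, {x | 1 + (j : ℝ) < u x ∧ u x ≤ 2 + j} := by
    intro x hx
    have hx' : 1 < u x := hx
    have hc : 0 < ⌈u x - 1⌉₊ := Nat.ceil_pos.2 (by linarith)
    obtain ⟨j, hj⟩ : ∃ j, ⌈u x - 1⌉₊ = j + 1 := Nat.exists_eq_succ_of_ne_zero hc.ne'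
    obtain ⟨h1, h2⟩ := (Nat.ceil_eq_iff (Nat.succ_ne_zero j)).1 hj
    simp only [Nat.succ_eq_add_one, Nat.add_sub_cancel] at h1
    push_cast at h2
    exact Set.mem_iUnion.2 ⟨j, by linarith, by linarith⟩
  have hpiece : ∀ j : ℕ, ∫⁻ x in {x | 1 + (j : ℝ) < u x ∧ u x ≤ 2 + j},
      ENNReal.ofReal (exp (4 * π * u x ^ 2) - 1) ≤ ENNReal.ofReal (a j * m) := by
    intro j
    have hfinj : volume {x | 1 + (j : ℝ) < u x} ≠ ⊤ := by
      refine measure_ne_top_of_subset (fun x (hx : 1 + (j : ℝ) < u x) => ?_) hfin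
      exact lt_of_le_of_lt (by linarith [(Nat.cast_nonneg j : (0 : ℝ) ≤ j)]) hx
    have hmj : MeasurableSet {x | 1 + (j : ℝ) < u x ∧ u x ≤ 2 + j} :=
      (measurableSet_lt measurable_const hud.continuous.measurable).inter
        (measurableSet_le hud.continuous.measurable measurable_const)
    calc _ ≤ ∫⁻ x in {x | 1 + (j : ℝ) < u x ∧ u x ≤ 2 + j},
          ENNReal.ofReal (exp (4 * π * ((j : ℝ) + 2) ^ 2)) := by
          refine setLIntegral_mono' hmj fun x hx => ENNReal.ofReal_le_ofReal ?_
          have h0 : 0 ≤ u x := by linarith [hx.1, (Nat.cast_nonneg j : (0 : ℝ) ≤ j)]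
          have h1 : u x ^ 2 ≤ ((j : ℝ) + 2) ^ 2 := pow_le_pow_left₀ h0 (by linarith [hx.2]) 2
          have h2 : exp (4 * π * u x ^ 2) ≤ exp (4 * π * ((j : ℝ) + 2) ^ 2) :=
            exp_le_exp.2 (mul_le_mul_of_nonneg_left h1 (by positivity))
          linarith
      _ ≤ ENNReal.ofReal (exp (4 * π * ((j : ℝ) + 2) ^ 2)) * volume {x | 1 + (j : ℝ) < u x} := by
          rw [setLIntegral_const]
          gcongr
          exact fun h => h.1
      _ = ENNReal.ofReal (exp (4 * π * ((j : ℝ) + 2) ^ 2) *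
            volume.real {x | 1 + (j : ℝ) < u x}) := by
          rw [ENNReal.ofReal_mul (exp_pos _).le, ofReal_measureReal hfinj]
      _ ≤ ENNReal.ofReal (a j * m) := by
          refine ENNReal.ofReal_le_ofReal ?_
          refine (mul_le_mul_of_nonneg_left (hdecay j) (exp_pos _).le).trans (le_of_eq ?_)
          rw [ha]
          simp only
          rw [mul_left_comm, ← exp_add, mul_comm m]
          congr 2
          field_simp
          ring
  calc _ ≤ ∫⁻ x in ⋃ j : ℕ, {x | 1 + (j : ℝ) < u x ∧ u x ≤ 2 + j},
        ENNReal.ofReal (exp (4 * π * u x ^ 2) - 1) := lintegral_mono_set hcover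
    _ ≤ ∑' j : ℕ, ∫⁻ x in {x | 1 + (j : ℝ) < u x ∧ u x ≤ 2 + j},
        ENNReal.ofReal (exp (4 * π * u x ^ 2) - 1) := lintegral_iUnion_le _ _
    _ ≤ ∑' j : ℕ, ENNReal.ofReal (a j * m) := ENNReal.tsum_le_tsum hpiece
    _ = ENNReal.ofReal ((∑' j, a j) * m) := by
        rw [← tsum_mul_right, ENNReal.ofReal_tsum_of_nonneg
          (fun j => mul_nonneg (ha0 j) measureReal_nonneg) (hsum.mul_right m)]
    _ ≤ _ := ENNReal.ofReal_le_ofReal (mul_le_mul_of_nonneg_left hcheb (tsum_nonneg ha0))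

lemma gradNorm_const_mul {u : Plane → ℝ} (hu : Differentiable ℝ u) (a : ℝ) (x : Plane) :
    gradNorm (fun x => a * u x) x = |a| * gradNorm u x := by
  rw [gradNorm, gradNorm, fderiv_const_mul (hu x), norm_smul, norm_eq_abs]

lemma MemH1.const_mul {u : Plane → ℝ} (hu : MemH1 u) (a : ℝ) : MemH1 fun x => a * u x := by
  refine ⟨hu.1.const_mul a, ?_, ?_⟩
  · simp_rw [mul_pow]
    exact hu.2.1.const_mul _
  · simp_rw [gradNorm_const_mul hu.1, mul_pow]
    exact hu.2.2.const_mul _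

/-- The subcritical Trudinger–Moser inequality on the plane. -/
lemma exists_const_trudinger_moser {κ : ℝ} (hκ1 : κ < 1) :
    ∃ C : ℝ, 0 < C ∧ ∀ u : Plane → ℝ, MemH1 u → ∫ x, gradNorm u x ^ 2 ≤ κ →
      ∫⁻ x, ENNReal.ofReal (exp (4 * π * u x ^ 2) - 1) ≤ ENNReal.ofReal (C * ∫ x, u x ^ 2) := by
  obtain ⟨C, hC, hbd⟩ := exists_const_lintegral_superlevel hκ1
  refine ⟨4 * π * exp (4 * π) + C + C, by positivity, fun u hu hκ => ?_⟩
  have hneg : MemH1 fun x => -1 * u x := hu.const_mul (-1)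
  have hp := hbd u hu hκ
  have hn := hbd _ hneg (by
    simp_rw [gradNorm_const_mul hu.1, abs_neg, abs_one, one_mul]
    exact hκ)
  simp only [mul_pow, neg_one_sq, one_mul] at hn
  have hum : Measurable u := hu.1.continuous.measurable
  have hmp : MeasurableSet {x | 1 < u x} := measurableSet_lt measurable_const hum
  have hmn : MeasurableSet {x | 1 < -1 * u x} :=
    measurableSet_lt measurable_const (hum.const_mul (-1))
  have hem : Measurable fun x => ENNReal.ofReal (exp (4 * π * u x ^ 2) - 1) := by fun_prop
  have hI : 0 ≤ ∫ x, u x ^ 2 := integral_nonneg fun x => sq_nonneg _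
  have hpt : ∀ x, ENNReal.ofReal (exp (4 * π * u x ^ 2) - 1) ≤
      ENNReal.ofReal (4 * π * exp (4 * π) * u x ^ 2) +
      {x | 1 < u x}.indicator (fun x => ENNReal.ofReal (exp (4 * π * u x ^ 2) - 1)) x +
      {x | 1 < -1 * u x}.indicator (fun x => ENNReal.ofReal (exp (4 * π * u x ^ 2) - 1)) x := by
    intro x
    by_cases h1 : 1 < u x
    · rw [Set.indicator_of_mem (s := {x | 1 < u x}) h1]
      exact le_add_right le_add_self
    by_cases h2 : 1 < -1 * u x
    · rw [Set.indicator_of_mem (s := {x | 1 < -1 * u x}) h2]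
      exact le_add_self
    refine le_add_right (le_add_right (ENNReal.ofReal_le_ofReal ?_))
    have hsq : u x ^ 2 ≤ 1 := (sq_le_one_iff_abs_le_one _).2 (abs_le.2 ⟨by linarith, by linarith⟩)
    set y := 4 * π * u x ^ 2
    have hy0 : 0 ≤ y := by positivity
    have hy : exp y ≤ exp (4 * π) := exp_le_exp.2 (mul_le_of_le_one_right (by positivity) hsq)
    have h3 : exp y - 1 ≤ y * exp y := by
      have h4 := mul_le_mul_of_nonneg_right (one_sub_le_exp_neg y) (exp_pos y).le
      rw [← exp_add, neg_add_cancel, exp_zero] at h4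
      linarith
    calc _ ≤ y * exp y := h3
      _ ≤ y * exp (4 * π) := mul_le_mul_of_nonneg_left hy hy0
      _ = _ := by simp only [y]; ring
  calc _ ≤ ∫⁻ x, (ENNReal.ofReal (4 * π * exp (4 * π) * u x ^ 2) +
      {x | 1 < u x}.indicator (fun x => ENNReal.ofReal (exp (4 * π * u x ^ 2) - 1)) x +
      {x | 1 < -1 * u x}.indicator (fun x => ENNReal.ofReal (exp (4 * π * u x ^ 2) - 1)) x) :=
        lintegral_mono hpt
    _ = (∫⁻ x, ENNReal.ofReal (4 * π * exp (4 * π) * u x ^ 2)) +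
        (∫⁻ x in {x | 1 < u x}, ENNReal.ofReal (exp (4 * π * u x ^ 2) - 1)) +
        ∫⁻ x in {x | 1 < -1 * u x}, ENNReal.ofReal (exp (4 * π * u x ^ 2) - 1) := by
        rw [lintegral_add_right _ (hem.indicator hmn), lintegral_add_right _ (hem.indicator hmp),
          lintegral_indicator hmn, lintegral_indicator hmp]
    _ ≤ ENNReal.ofReal (4 * π * exp (4 * π) * ∫ x, u x ^ 2) + ENNReal.ofReal (C * ∫ x, u x ^ 2) +
        ENNReal.ofReal (C * ∫ x, u x ^ 2) := by
        gcongr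
        rw [← integral_const_mul, ofReal_integral_eq_lintegral_ofReal (hu.2.1.const_mul _)
          (Filter.Eventually.of_forall fun x => by positivity)]
    _ = _ := by
        rw [← ENNReal.ofReal_add (by positivity) (by positivity),
          ← ENNReal.ofReal_add (by positivity) (by positivity)]
        congr 1
        ring

lemma exists_cutoff {r : ℝ} (hr : 0 < r) :
    ∃ χ : Plane → ℝ, Differentiable ℝ χ ∧ (∀ x, 0 ≤ χ x) ∧ (∀ x, χ x ≤ 1) ∧
      (∀ x, ‖x‖ ≤ r / 2 → χ x = 1) ∧ (∀ x, r < ‖x‖ → χ x = 0) ∧ ∀ x, gradNorm χ x ≤ 4 / r := by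
  obtain ⟨φ, φ', hd, h0, h1, hz, hφa, hφb, hb, -⟩ :=
    exists_truncation (a := 1 / 4) (b := 1) (t := 1 / 2) (by norm_num) (by norm_num)
  have hmono : Monotone φ := monotone_of_hasDerivAt_nonneg hd h0
  have hpos : 0 < φ 1 := by linarith
  have hle : ∀ s, φ s ≤ φ 1 := fun s => by
    rcases le_total s 1 with h | h
    · exact hmono h
    · exact (hφb s h).le
  have hnn : ∀ s, 0 ≤ φ s := fun s => by
    rcases le_total s (1 / 4) with h | h
    · exact (hφa s h).ge
    · exact (hφa (1 / 4) le_rfl).ge.trans (hmono h)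
  have hder : ∀ x : Plane, HasFDerivAt (fun x : Plane => 1 - (φ 1)⁻¹ * φ ((r ^ 2)⁻¹ * ‖x‖ ^ 2))
      (-((φ 1)⁻¹ • φ' ((r ^ 2)⁻¹ * ‖x‖ ^ 2) • (r ^ 2)⁻¹ • (2 • innerSL ℝ x))) x := by
    intro x
    have hs : HasFDerivAt (fun x : Plane => (r ^ 2)⁻¹ * ‖x‖ ^ 2)
        ((r ^ 2)⁻¹ • (2 • innerSL ℝ x)) x :=
      (hasStrictFDerivAt_norm_sq x).hasFDerivAt.const_mul _
    exact (((hd _).comp_hasFDerivAt x hs).const_mul _).const_sub 1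
  have hscale : ∀ x : Plane, (r ^ 2)⁻¹ * ‖x‖ ^ 2 = (‖x‖ / r) ^ 2 := fun x => by
    rw [div_pow]; field_simp
  refine ⟨_, fun x => (hder x).differentiableAt, fun x => ?_, fun x => ?_, fun x hx => ?_,
    fun x hx => ?_, fun x => ?_⟩
  · rw [sub_nonneg, inv_mul_le_iff₀ hpos, mul_one]
    exact hle _
  · exact sub_le_self _ (mul_nonneg (inv_nonneg.2 hpos.le) (hnn _))
  · have : ‖x‖ / r ≤ 1 / 2 := by rw [div_le_iff₀ hr]; linarith
    have h : φ ((r ^ 2)⁻¹ * ‖x‖ ^ 2) = 0 := by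
      refine hφa _ ?_
      rw [hscale]
      calc (‖x‖ / r) ^ 2 ≤ (1 / 2) ^ 2 := by gcongr
        _ = 1 / 4 := by norm_num
    rw [h, mul_zero, sub_zero]
  · have h : φ ((r ^ 2)⁻¹ * ‖x‖ ^ 2) = φ 1 := by
      refine hφb _ ?_
      rw [hscale]
      exact one_le_pow₀ ((one_le_div hr).2 hx.le)
    rw [h, inv_mul_cancel₀ hpos.ne', sub_self]
  · rw [gradNorm, (hder x).fderiv, norm_neg]
    by_cases hx : ‖x‖ < r
    · have hφ1 : (φ 1)⁻¹ ≤ 2 := by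
        rw [inv_le_comm₀ hpos two_pos]
        linarith
      have h2 : ‖(2 • innerSL ℝ x : Plane →L[ℝ] ℝ)‖ ≤ 2 * r := by
        rw [two_nsmul]
        refine (norm_add_le _ _).trans ?_
        rw [innerSL_apply_norm]
        linarith
      rw [norm_smul, norm_smul, norm_smul, norm_eq_abs, norm_eq_abs, norm_eq_abs,
        abs_of_pos (inv_pos.2 hpos), abs_of_nonneg (h0 _), abs_of_pos (by positivity)]
      have h3 := h1 ((r ^ 2)⁻¹ * ‖x‖ ^ 2)
      have h4 := h0 ((r ^ 2)⁻¹ * ‖x‖ ^ 2)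
      calc _ ≤ 2 * (1 * ((r ^ 2)⁻¹ * (2 * r))) := by gcongr
        _ = 4 / r := by field_simp; norm_num
    · rw [hz, zero_smul, smul_zero, norm_zero]
      · positivity
      · intro h
        refine not_lt.2 ?_ h.2
        rw [hscale]
        exact one_le_pow₀ ((one_le_div hr).2 (not_lt.1 hx))

/-- Averaging local inequalities over all centres. -/
lemma lintegral_le_of_forall_closedBall {g h : Plane → ℝ≥0∞} (hg : Measurable g)
    (hh : Measurable h) {ρ r : ℝ}
    (hloc : ∀ c, ∫⁻ x in Metric.closedBall c ρ, g x ≤ ∫⁻ x in Metric.closedBall c r, h x) :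
    volume (Metric.closedBall (0 : Plane) ρ) * ∫⁻ x, g x ≤
      volume (Metric.closedBall (0 : Plane) r) * ∫⁻ x, h x := by
  have key : ∀ (g : Plane → ℝ≥0∞) (s : ℝ), Measurable g →
      ∫⁻ c, ∫⁻ x in Metric.closedBall c s, g x =
        volume (Metric.closedBall (0 : Plane) s) * ∫⁻ x, g x := by
    intro g s hg
    have hms : MeasurableSet {q : Plane × Plane | dist q.2 q.1 ≤ s} :=
      measurableSet_le (measurable_snd.dist measurable_fst) measurable_const
    calc ∫⁻ c, ∫⁻ x in Metric.closedBall c s, g x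
        = ∫⁻ c, ∫⁻ x, {q : Plane × Plane | dist q.2 q.1 ≤ s}.indicator (fun q => g q.2) (c, x) := by
          refine lintegral_congr fun c => ?_
          rw [← lintegral_indicator Metric.isClosed_closedBall.measurableSet]
          rfl
      _ = ∫⁻ x, ∫⁻ c, {q : Plane × Plane | dist q.2 q.1 ≤ s}.indicator (fun q => g q.2) (c, x) :=
          lintegral_lintegral_swap ((hg.comp measurable_snd).indicator hms).aemeasurable
      _ = ∫⁻ x, ∫⁻ c in Metric.closedBall x s, g x := by
          refine lintegral_congr fun x => ?_
          rw [← lintegral_indicator Metric.isClosed_closedBall.measurableSet]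
          refine lintegral_congr fun c => ?_
          simp only [Set.indicator, Set.mem_ofPred_eq, Metric.mem_closedBall, dist_comm]
      _ = _ := by
          simp_rw [setLIntegral_const, Measure.addHaar_closedBall_center]
          rw [lintegral_mul_const _ hg, mul_comm]
  rw [← key g ρ hg, ← key h r hh]
  exact lintegral_mono hloc

lemma gradNorm_mul_le {χ u : Plane → ℝ} (hχ : Differentiable ℝ χ) (hu : Differentiable ℝ u)
    (x : Plane) :
    gradNorm (fun x => χ x * u x) x ≤ |χ x| * gradNorm u x + |u x| * gradNorm χ x := by
  rw [gradNorm, fderiv_fun_mul (hχ x) (hu x)]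
  refine (norm_add_le _ _).trans_eq ?_
  rw [norm_smul, norm_smul, norm_eq_abs, norm_eq_abs, gradNorm, gradNorm]

lemma gradNorm_comp_sub (u : Plane → ℝ) (c x : Plane) :
    gradNorm (fun x => u (x - c)) x = gradNorm u (x - c) := by
  rw [gradNorm, gradNorm, fderiv_comp_sub]

/-- A function in `H¹` can be localized to a ball, at a controlled cost in energy. -/
lemma MemH1.exists_localized {u : Plane → ℝ} (hu : MemH1 u) {r : ℝ} (hr : 0 < r) {s : ℝ}
    (hs : 0 < s) (c : Plane) :
    ∃ v : Plane → ℝ, MemH1 v ∧ (∀ x ∈ Metric.closedBall c (r / 2), v x = u x) ∧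
      ∫ x, v x ^ 2 ≤ ∫ x in Metric.closedBall c r, u x ^ 2 ∧
      ∫ x, gradNorm v x ^ 2 ≤ (1 + s) * (∫ x in Metric.closedBall c r, gradNorm u x ^ 2) +
        (1 + s⁻¹) * (4 / r) ^ 2 * ∫ x, u x ^ 2 := by
  obtain ⟨χ, hχd, hχ0, hχ1, hχin, hχout, hχg⟩ := exists_cutoff hr
  obtain ⟨hud, hu2, hug⟩ := hu
  have hB : MeasurableSet (Metric.closedBall c r) := Metric.isClosed_closedBall.measurableSet
  have hχcd : Differentiable ℝ fun x => χ (x - c) := hχd.comp (differentiable_id.sub_const c)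
  set v : Plane → ℝ := fun x => χ (x - c) * u x with hv
  have hvd : Differentiable ℝ v := hχcd.mul hud
  have hout : ∀ x ∉ Metric.closedBall c r, χ (x - c) = 0 := fun x hx =>
    hχout _ (by rwa [Metric.mem_closedBall, dist_eq_norm, not_le] at hx)
  have hv2 : ∀ x, v x ^ 2 ≤ (Metric.closedBall c r).indicator (fun x => u x ^ 2) x := by
    intro x
    by_cases hx : x ∈ Metric.closedBall c r
    · rw [Set.indicator_of_mem hx, hv]
      simp only [mul_pow]
      exact mul_le_of_le_one_left (sq_nonneg _) (pow_le_one₀ (hχ0 _) (hχ1 _))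
    · rw [Set.indicator_of_notMem hx, hv]
      simp [hout x hx]
  have hvg : ∀ x, gradNorm v x ^ 2 ≤
      (Metric.closedBall c r).indicator (fun x => (1 + s) * gradNorm u x ^ 2) x +
        (1 + s⁻¹) * (4 / r) ^ 2 * u x ^ 2 := by
    intro x
    have h0 : 0 ≤ gradNorm v x := norm_nonneg _
    have h1 := gradNorm_mul_le hχcd hud x
    rw [gradNorm_comp_sub, abs_of_nonneg (hχ0 _)] at h1
    have hP : 0 ≤ gradNorm u x := norm_nonneg _
    have h2 : |u x| * gradNorm χ (x - c) ≤ |u x| * (4 / r) :=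
      mul_le_mul_of_nonneg_left (hχg _) (abs_nonneg _)
    have hQ : (|u x| * (4 / r)) ^ 2 = (4 / r) ^ 2 * u x ^ 2 := by
      rw [mul_pow, sq_abs, mul_comm]
    have hQ0 : 0 ≤ |u x| * (4 / r) := by positivity
    by_cases hx : x ∈ Metric.closedBall c r
    · rw [Set.indicator_of_mem hx]
      have h3 : gradNorm v x ≤ gradNorm u x + |u x| * (4 / r) :=
        h1.trans (add_le_add (mul_le_of_le_one_left hP (hχ1 _)) h2)
      rw [mul_assoc, ← hQ]
      generalize |u x| * (4 / r) = Q at *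
      generalize gradNorm u x = P at *
      have h4 : (P + Q) ^ 2 + s⁻¹ * (s * P - Q) ^ 2 = (1 + s) * P ^ 2 + (1 + s⁻¹) * Q ^ 2 := by
        field_simp
        ring
      have h5 : 0 ≤ s⁻¹ * (s * P - Q) ^ 2 := by positivity
      linarith [pow_le_pow_left₀ h0 h3 2]
    · rw [Set.indicator_of_notMem hx, zero_add, mul_assoc, ← hQ]
      rw [hout x hx, zero_mul, zero_add] at h1
      have h3 := pow_le_pow_left₀ h0 (h1.trans h2) 2
      have h5 : 0 ≤ s⁻¹ * (|u x| * (4 / r)) ^ 2 := by positivity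
      linarith
  have hi2 : Integrable fun x => (Metric.closedBall c r).indicator (fun x => u x ^ 2) x :=
    hu2.indicator hB
  have hig1 : Integrable fun x =>
      (Metric.closedBall c r).indicator (fun x => (1 + s) * gradNorm u x ^ 2) x :=
    (hug.const_mul _).indicator hB
  have hig2 : Integrable fun x => (1 + s⁻¹) * (4 / r) ^ 2 * u x ^ 2 := hu2.const_mul _
  have hv2i : Integrable fun x => v x ^ 2 :=
    hi2.mono' (hvd.continuous.pow 2).aestronglyMeasurable (Filter.Eventually.of_forall fun x => by
      rw [norm_of_nonneg (sq_nonneg _)]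
      exact hv2 x)
  have hvgi : Integrable fun x => gradNorm v x ^ 2 :=
    (hig1.add hig2).mono' ((measurable_fderiv ℝ v).norm.pow_const 2).aestronglyMeasurable
      (Filter.Eventually.of_forall fun x => by
        rw [norm_of_nonneg (sq_nonneg _)]
        exact hvg x)
  refine ⟨v, ⟨hvd, hv2i, hvgi⟩, fun x hx => ?_, ?_, ?_⟩
  · rw [hv]
    simp only
    rw [hχin _ (by rwa [Metric.mem_closedBall, dist_eq_norm] at hx), one_mul]
  · rw [← integral_indicator hB]
    exact integral_mono hv2i hi2 hv2
  · rw [← integral_const_mul, ← integral_const_mul, ← integral_indicator hB,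
      ← integral_add hig1 hig2]
    exact integral_mono hvgi (hig1.add hig2) hvg

lemma MemH1.setIntegral_gradNorm_sq_le {u : Plane → ℝ} (hu : MemH1 u) (r : ℝ) (c : Plane) :
    ∫ x in Metric.closedBall c r, gradNorm u x ^ 2 ≤ H1locSq r u := by
  have hi : Integrable fun x => gradNorm u x ^ 2 + u x ^ 2 := hu.2.2.add hu.2.1
  have hbdd : BddAbove (Set.range fun c : Plane =>
      ∫ x in Metric.closedBall c r, (gradNorm u x ^ 2 + u x ^ 2)) := by
    refine ⟨∫ x, (gradNorm u x ^ 2 + u x ^ 2), ?_⟩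
    rintro _ ⟨c, rfl⟩
    exact setIntegral_le_integral hi (Filter.Eventually.of_forall fun x => by positivity)
  refine le_trans ?_ (le_ciSup hbdd c)
  refine integral_mono hu.2.2.integrableOn hi.integrableOn fun x => ?_
  exact le_add_of_nonneg_right (sq_nonneg _)

lemma lintegral_exp_mul_sq_le_of_small_local {u : Plane → ℝ} {θ r lam C : ℝ} (hθ : 0 < θ)
    (hr : 0 < r) (hlam : 1 < lam) (hC : 0 < C)
    (hTM : ∀ v : Plane → ℝ, MemH1 v →
      ∫ x, gradNorm v x ^ 2 ≤ (√(θ * lam) + 4 * √(2 * (lam - 1)) / r) ^ 2 →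
      ∫⁻ x, ENNReal.ofReal (exp (4 * π * v x ^ 2) - 1) ≤ ENNReal.ofReal (C * ∫ x, v x ^ 2))
    (hu : MemH1 u) (hloc : H1locSq r u ≤ θ) (hL2 : lam * ∫ x, u x ^ 2 ≤ 2 * (lam - 1)) :
    volume (Metric.closedBall (0 : Plane) (r / 2)) *
        ∫⁻ x, ENNReal.ofReal (exp (4 * π * lam * u x ^ 2) - 1) ≤
      volume (Metric.closedBall (0 : Plane) r) * ENNReal.ofReal (C * lam * ∫ x, u x ^ 2) := by
  have hlam0 : 0 < lam := by linarith
  have hum : Measurable u := hu.1.continuous.measurable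
  have hi : Integrable fun x => C * lam * u x ^ 2 := hu.2.1.const_mul _
  have hnn : ∀ x, 0 ≤ C * lam * u x ^ 2 := fun x => by positivity
  rw [← integral_const_mul, ofReal_integral_eq_lintegral_ofReal hi
    (Filter.Eventually.of_forall hnn)]
  refine lintegral_le_of_forall_closedBall (by fun_prop) (by fun_prop) fun c => ?_
  set α := √(θ * lam) with hα
  set γ := √(2 * (lam - 1)) with hγ
  have hα0 : 0 < α := sqrt_pos.2 (by positivity)
  have hγ0 : 0 < γ := sqrt_pos.2 (by linarith)
  have hα2 : α ^ 2 = θ * lam := sq_sqrt (by positivity)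
  have hγ2 : γ ^ 2 = 2 * (lam - 1) := sq_sqrt (by linarith)
  have hs : 0 < 4 * γ / r / α := by positivity
  obtain ⟨v, hv, hveq, hv2, hvg⟩ := hu.exists_localized hr hs c
  have hsq : ∀ x, (√lam * v x) ^ 2 = lam * v x ^ 2 := fun x => by
    rw [mul_pow, sq_sqrt hlam0.le]
  have henergy : ∫ x, gradNorm (fun x => √lam * v x) x ^ 2 ≤ (α + 4 * γ / r) ^ 2 := by
    simp_rw [gradNorm_const_mul hv.1, mul_pow, sq_abs, sq_sqrt hlam0.le]
    rw [integral_const_mul]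
    calc lam * ∫ x, gradNorm v x ^ 2
        ≤ lam * ((1 + 4 * γ / r / α) * θ +
          (1 + (4 * γ / r / α)⁻¹) * (4 / r) ^ 2 * ∫ x, u x ^ 2) := by
          refine mul_le_mul_of_nonneg_left (hvg.trans ?_) hlam0.le
          gcongr
          exact (hu.setIntegral_gradNorm_sq_le r c).trans hloc
      _ = (1 + 4 * γ / r / α) * (θ * lam) +
          (1 + (4 * γ / r / α)⁻¹) * (4 / r) ^ 2 * (lam * ∫ x, u x ^ 2) := by ring
      _ ≤ (1 + 4 * γ / r / α) * α ^ 2 + (1 + (4 * γ / r / α)⁻¹) * (4 / r) ^ 2 * γ ^ 2 := by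
          rw [hα2, hγ2]
          gcongr
      _ = (α + 4 * γ / r) ^ 2 := by
          field_simp
          ring
  have hmain := hTM _ (hv.const_mul (√lam)) henergy
  simp_rw [hsq] at hmain
  calc ∫⁻ x in Metric.closedBall c (r / 2), ENNReal.ofReal (exp (4 * π * lam * u x ^ 2) - 1)
      = ∫⁻ x in Metric.closedBall c (r / 2),
          ENNReal.ofReal (exp (4 * π * (lam * v x ^ 2)) - 1) := by
        refine setLIntegral_congr_fun Metric.isClosed_closedBall.measurableSet fun x hx => ?_
        simp only [hveq x hx, mul_assoc]
    _ ≤ ∫⁻ x, ENNReal.ofReal (exp (4 * π * (lam * v x ^ 2)) - 1) :=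
        setLIntegral_le_lintegral _ _
    _ ≤ ENNReal.ofReal (C * ∫ x, lam * v x ^ 2) := hmain
    _ ≤ ENNReal.ofReal (∫ x in Metric.closedBall c r, C * lam * u x ^ 2) := by
        rw [integral_const_mul, integral_const_mul, mul_assoc]
        gcongr
    _ = ∫⁻ x in Metric.closedBall c r, ENNReal.ofReal (C * lam * u x ^ 2) :=
        ofReal_integral_eq_lintegral_ofReal hi.integrableOn (Filter.Eventually.of_forall hnn)

/-- improved Trudinger–Moser inequality under a smallness assumption on the
local `H¹` norm (Lemma 6.6). -/
theorem statement2 (θ r lam : ℝ) (hθ : θ ∈ Set.Ioo (0:ℝ) 1) (hr : 0 < r)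
    (hlam : 1 < lam)
    (hcond : (Real.sqrt (θ * lam) + 4 * Real.sqrt (2 * (lam - 1)) / r) ^ 2
        + 2 * (lam - 1) < 1) :
    ∃ C : ℝ, 0 < C ∧ ∀ u : Plane → ℝ, MemH1 u →
      (∫ x : Plane, gradNorm u x ^ 2) + (∫ x : Plane, u x ^ 2) ≤ 1 →
      H1locSq r u ≤ θ →
      ∫⁻ x : Plane, ENNReal.ofReal (Real.exp (4 * π * lam * u x ^ 2) - 1) ≤
        ENNReal.ofReal (C * ∫ x : Plane, u x ^ 2) := by
  have hlam0 : 0 < lam := by linarith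
  obtain ⟨C₁, hC₁, hTM₁⟩ := exists_const_trudinger_moser (κ := 2 - lam) (by linarith)
  obtain ⟨C₂, hC₂, hTM₂⟩ := exists_const_trudinger_moser
    (κ := (√(θ * lam) + 4 * √(2 * (lam - 1)) / r) ^ 2) (by linarith)
  set V := volume.real (Metric.closedBall (0 : Plane) r) with hV
  set V' := volume.real (Metric.closedBall (0 : Plane) (r / 2)) with hV'
  have hV0 : 0 ≤ V := measureReal_nonneg
  have hV'0 : 0 < V' := ENNReal.toReal_pos
    (Metric.measure_closedBall_pos volume _ (half_pos hr)).ne' measure_closedBall_lt_top.ne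
  refine ⟨C₁ * lam + V / V' * (C₂ * lam), by positivity, fun u hu hnorm hloc => ?_⟩
  have hI : 0 ≤ ∫ x, u x ^ 2 := integral_nonneg fun x => sq_nonneg _
  by_cases hcase : lam * ∫ x, gradNorm u x ^ 2 ≤ 2 - lam
  · have hsq : ∀ x, (√lam * u x) ^ 2 = lam * u x ^ 2 := fun x => by
      rw [mul_pow, sq_sqrt hlam0.le]
    have hmain := hTM₁ _ (hu.const_mul (√lam)) (by
      simp_rw [gradNorm_const_mul hu.1, mul_pow, sq_abs, sq_sqrt hlam0.le]
      rwa [integral_const_mul])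
    simp_rw [hsq, integral_const_mul, ← mul_assoc] at hmain
    refine hmain.trans (ENNReal.ofReal_le_ofReal (mul_le_mul_of_nonneg_right ?_ hI))
    exact le_add_of_nonneg_right (by positivity)
  · have hL2 : lam * ∫ x, u x ^ 2 ≤ 2 * (lam - 1) := by nlinarith
    have hmain := lintegral_exp_mul_sq_le_of_small_local hθ.1 hr hlam hC₂ hTM₂ hu hloc hL2
    rw [← ofReal_measureReal (measure_closedBall_lt_top.ne),
      ← ofReal_measureReal (μ := volume) (s := Metric.closedBall (0 : Plane) r)
        (measure_closedBall_lt_top.ne), ← hV, ← hV', ← ENNReal.ofReal_mul hV0,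
      ENNReal.mul_le_iff_le_inv (ENNReal.ofReal_pos.2 hV'0).ne' ENNReal.ofReal_ne_top,
      ← ENNReal.ofReal_inv_of_pos hV'0, ← ENNReal.ofReal_mul (inv_nonneg.2 hV'0.le)] at hmain
    refine hmain.trans (ENNReal.ofReal_le_ofReal ?_)
    have h1 : 0 ≤ C₁ * lam * ∫ x, u x ^ 2 := by positivity
    calc _ = V / V' * (C₂ * lam) * ∫ x, u x ^ 2 := by ring
      _ ≤ _ := by linarith
end
end
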